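/- arXiv:1107.1153 — 3 statements merged into one kernel-verified Lean document; each statement's English description precedes it below -/
import Mathlib

section
/- Let H be the bipartite graph on vertices {x, y₁,…,y_m, v₁,…,v_k} where x is joined to all of v₁,…,v_k and each y_t is joined to a subset S_t ⊆ {v₁,…,v_k} with |S_t| = a_t. Let e = k + Σ_{t=1}^m a_t. Then for every bounded symmetric measurable W : [0,1]² → ℝ≥0 with d = ∫∫ W, we have t(H, W) ≥ d^e. -/
open MeasureTheory Real unitInterval

open ProbabilityTheory Function

/-- A measurable real function bounded above and bounded below by a positive constant. -/
structure IsBddPos {Ω : Type*} [MeasurableSpace Ω] (f : Ω → ℝ) : Prop where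
  measurable : Measurable f
  exists_bounds : ∃ c C : ℝ, 0 < c ∧ ∀ x, c ≤ f x ∧ f x ≤ C

namespace IsBddPos

variable {Ω Ω' κ : Type*} [MeasurableSpace Ω] [MeasurableSpace Ω'] {f g : Ω → ℝ}

theorem pos (hf : IsBddPos f) (x : Ω) : 0 < f x := by
  obtain ⟨c, C, hc, h⟩ := hf.exists_bounds
  exact hc.trans_le (h x).1

theorem const {c : ℝ} (hc : 0 < c) : IsBddPos fun _ : Ω => c :=
  ⟨measurable_const, c, c, hc, fun _ => ⟨le_rfl, le_rfl⟩⟩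

theorem mul (hf : IsBddPos f) (hg : IsBddPos g) : IsBddPos fun x => f x * g x := by
  obtain ⟨c, C, hc, h⟩ := hf.exists_bounds
  obtain ⟨c', C', hc', h'⟩ := hg.exists_bounds
  refine ⟨hf.measurable.mul hg.measurable, c * c', C * C', mul_pos hc hc', fun x => ⟨?_, ?_⟩⟩
  · exact mul_le_mul (h x).1 (h' x).1 hc'.le (hf.pos x).le
  · exact mul_le_mul (h x).2 (h' x).2 (hg.pos x).le ((hf.pos x).le.trans (h x).2)

theorem inv (hf : IsBddPos f) : IsBddPos fun x => (f x)⁻¹ := by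
  obtain ⟨c, C, hc, h⟩ := hf.exists_bounds
  refine ⟨hf.measurable.inv, (max C 1)⁻¹, c⁻¹, by positivity, fun x => ⟨?_, ?_⟩⟩
  · exact inv_anti₀ (hf.pos x) ((h x).2.trans (le_max_left _ _))
  · exact inv_anti₀ hc (h x).1

theorem div (hf : IsBddPos f) (hg : IsBddPos g) : IsBddPos fun x => f x / g x := by
  simpa only [div_eq_mul_inv] using hf.mul hg.inv

theorem prod {F : κ → Ω → ℝ} (s : Finset κ) (hF : ∀ t ∈ s, IsBddPos (F t)) :
    IsBddPos fun x => ∏ t ∈ s, F t x := by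
  classical
  induction s using Finset.induction_on with
  | empty => simpa using const one_pos
  | insert a s ha ih =>
    simp only [Finset.prod_insert ha]
    exact (hF a (by simp)).mul (ih fun t ht => hF t (by simp [ht]))

theorem pow (hf : IsBddPos f) (n : ℕ) : IsBddPos fun x => f x ^ n := by
  simpa using prod (Finset.range n) fun _ _ => hf

theorem comp (hf : IsBddPos f) {φ : Ω' → Ω} (hφ : Measurable φ) : IsBddPos fun x => f (φ x) := by
  obtain ⟨c, C, hc, h⟩ := hf.exists_bounds
  exact ⟨hf.measurable.comp hφ, c, C, hc, fun x => h (φ x)⟩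

theorem integrable (hf : IsBddPos f) (μ : Measure Ω) [IsFiniteMeasure μ] : Integrable f μ := by
  obtain ⟨c, C, hc, h⟩ := hf.exists_bounds
  refine .of_bound hf.measurable.aestronglyMeasurable C (.of_forall fun x => ?_)
  rw [Real.norm_of_nonneg (hf.pos x).le]
  exact (h x).2

theorem integral_prod_right {F : Ω → Ω' → ℝ} (hF : IsBddPos (uncurry F)) (μ : Measure Ω')
    [IsProbabilityMeasure μ] : IsBddPos fun x => ∫ y, F x y ∂μ := by
  obtain ⟨c, C, hc, h⟩ := hF.exists_bounds
  refine ⟨hF.measurable.stronglyMeasurable.integral_prod_right.measurable, c, C, hc,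
    fun x => ?_⟩
  have hx : Integrable (F x) μ := (hF.comp measurable_prodMk_left).integrable μ
  constructor
  · simpa using integral_mono (integrable_const c) hx fun y => (h (x, y)).1
  · simpa using integral_mono hx (integrable_const C) fun y => (h (x, y)).2

theorem integral_pos (hf : IsBddPos f) (μ : Measure Ω) [IsProbabilityMeasure μ] :
    0 < ∫ x, f x ∂μ :=
  (integral_prod_right (F := fun (_ : Unit) x => f x) (hf.comp measurable_snd) μ).pos ()

theorem integrable_mul_log (hf : IsBddPos f) (hg : IsBddPos g) (μ : Measure Ω)
    [IsFiniteMeasure μ] : Integrable (fun x => f x * log (g x)) μ := by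
  obtain ⟨c, C, hc, h⟩ := hg.exists_bounds
  refine (hf.integrable μ).mul_bdd (c := max |log c| |log C|)
    hg.measurable.log.aestronglyMeasurable (.of_forall fun x => ?_)
  exact abs_le_max_abs_abs (log_le_log hc (h x).1) (log_le_log (hg.pos x) (h x).2)

/-- Jensen's inequality for the logarithm, with respect to a probability density. -/
theorem integral_mul_log_le_log_integral_mul (hf : IsBddPos f) (hg : IsBddPos g) (μ : Measure Ω)
    [IsProbabilityMeasure μ] (hf1 : ∫ x, f x ∂μ = 1) :
    ∫ x, f x * log (g x) ∂μ ≤ log (∫ x, f x * g x ∂μ) := by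
  set M := ∫ x, f x * g x ∂μ with hM
  have hMpos : 0 < M := (hf.mul hg).integral_pos μ
  have key : ∀ x, f x * log (g x) ≤ M⁻¹ * (f x * g x) + (log M - 1) * f x := fun x => by
    have h := log_le_sub_one_of_pos (div_pos (hg.pos x) hMpos)
    rw [log_div (hg.pos x).ne' hMpos.ne'] at h
    have := mul_le_mul_of_nonneg_left h (hf.pos x).le
    rw [div_eq_mul_inv] at this
    linarith
  calc ∫ x, f x * log (g x) ∂μ
      ≤ ∫ x, (M⁻¹ * (f x * g x) + (log M - 1) * f x) ∂μ :=
        integral_mono (hf.integrable_mul_log hg μ)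
          ((((hf.mul hg).integrable μ).const_mul _).add ((hf.integrable μ).const_mul _)) key
    _ = log M := by
        rw [integral_add (((hf.mul hg).integrable μ).const_mul _) ((hf.integrable μ).const_mul _),
          integral_const_mul, integral_const_mul, hf1, ← hM, inv_mul_cancel₀ hMpos.ne']
        ring

end IsBddPos

/-- Integrating out the coordinates outside `S` against a probability density. -/
theorem integral_prod_compl_mul_restrict {ι β : Type*} [Fintype ι] [DecidableEq ι]
    [MeasurableSpace β] (ν : Measure β) [IsProbabilityMeasure ν] (S : Finset ι) {q : β → ℝ}
    (hq : Measurable q) (hq1 : ∫ b, q b ∂ν = 1) {Φ : (S → β) → ℝ} (hΦ : Measurable Φ) :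
    ∫ v : ι → β, (∏ i ∈ Sᶜ, q (v i)) * Φ (S.restrict v) ∂(Measure.pi fun _ => ν) =
      ∫ v : ι → β, Φ (S.restrict v) ∂(Measure.pi fun _ => ν) := by
  have hind : iIndepFun (fun (i : ι) (v : ι → β) => v i) (Measure.pi fun _ => ν) :=
    iIndepFun_pi (X := fun _ b => b) fun _ => aemeasurable_id
  have h := (hind.indepFun_finset Sᶜ S disjoint_compl_left fun i => measurable_pi_apply i).comp
    (φ := fun u => ∏ i, q (u i)) (ψ := Φ) (by fun_prop) hΦ
  have h' := h.integral_fun_mul_eq_mul_integral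
    (Measurable.aestronglyMeasurable (by fun_prop)) (Measurable.aestronglyMeasurable (by fun_prop))
  have hprod (v : ι → β) : ∏ i : (Sᶜ : Finset ι), q (v i) = ∏ i ∈ Sᶜ, q (v i) :=
    Finset.prod_coe_sort Sᶜ fun i => q (v i)
  have hone : ∫ v : ι → β, ∏ i ∈ Sᶜ, q (v i) ∂(Measure.pi fun _ => ν) = 1 := by
    have := integral_fintype_prod_eq_prod (μ := fun _ : ι => ν)
      (fun i b => if i ∈ Sᶜ then q b else 1)
    rw [Finset.prod_eq_one (by intro i _; by_cases hi : i ∈ S <;> simp [hi, hq1])] at this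
    simpa only [Finset.prod_ite_mem, Finset.univ_inter] using this
  simp only [comp_def, hprod, hone, one_mul] at h'
  exact h'

section Star

variable {α β ι : Type*} [MeasurableSpace α] [MeasurableSpace β] {W : α → β → ℝ}

theorem IsBddPos.edge (hW : IsBddPos (uncurry W)) (i : ι) :
    IsBddPos fun p : α × (ι → β) => W p.1 (p.2 i) :=
  hW.comp (φ := fun p : α × (ι → β) => (p.1, p.2 i)) (by fun_prop)

/-- The weighted number of common neighbours of the vertices `v i` with `i ∈ S`. -/
noncomputable def codegree (W : α → β → ℝ) (μ : Measure α) (S : Finset ι) (v : ι → β) : ℝ :=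
  ∫ y, ∏ j ∈ S, W y (v j) ∂μ

theorem IsBddPos.codegree (hW : IsBddPos (uncurry W)) (μ : Measure α) [IsProbabilityMeasure μ]
    (S : Finset ι) : IsBddPos (codegree W μ S) :=
  IsBddPos.integral_prod_right (F := fun (v : ι → β) y => ∏ j ∈ S, W y (v j))
    ((IsBddPos.prod S fun j _ => hW.edge j).comp measurable_swap) μ

variable [Fintype ι]

/-- The density of the law of a random star with leaves indexed by `ι`: the centre is chosen
proportionally to its degree and the leaves are independent random neighbours of it. -/
noncomputable def starDensity (W : α → β → ℝ) (μ : Measure α) (ν : Measure β)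
    (p : α × (ι → β)) : ℝ :=
  (∫ b, W p.1 b ∂ν) / (∫ x, ∫ b, W x b ∂ν ∂μ) * ∏ i, W p.1 (p.2 i) / ∫ b, W p.1 b ∂ν

variable (μ : Measure α) (ν : Measure β) [IsProbabilityMeasure μ] [IsProbabilityMeasure ν]

theorem IsBddPos.starDensity (hW : IsBddPos (uncurry W)) :
    IsBddPos (starDensity W μ ν : α × (ι → β) → ℝ) := by
  have hD := (hW.integral_prod_right ν).comp (measurable_fst (α := α) (β := ι → β))
  exact (hD.div (.const ((hW.integral_prod_right ν).integral_pos μ))).mul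
    (.prod _ fun i _ => (hW.edge i).div hD)

theorem integral_div_integral_self (hW : IsBddPos (uncurry W)) (x : α) :
    ∫ b, W x b / (∫ b, W x b ∂ν) ∂ν = 1 := by
  rw [integral_div, div_self ((hW.integral_prod_right ν).pos x).ne']

theorem integral_starDensity_mul_fst (hW : IsBddPos (uncurry W)) {φ : α → ℝ} (hφ : IsBddPos φ) :
    ∫ p : α × (ι → β), starDensity W μ ν p * φ p.1 ∂(μ.prod (Measure.pi fun _ => ν)) =
      ∫ x, (∫ b, W x b ∂ν) / (∫ x, ∫ b, W x b ∂ν ∂μ) * φ x ∂μ := by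
  rw [integral_prod _ (((hW.starDensity μ ν).mul (hφ.comp measurable_fst)).integrable _)]
  refine integral_congr_ae (.of_forall fun x => ?_)
  simp only [starDensity]
  rw [integral_mul_const, integral_const_mul,
    integral_fintype_prod_eq_pow (fun b => W x b / ∫ b, W x b ∂ν),
    integral_div_integral_self ν hW, one_pow, mul_one]

theorem integral_starDensity (hW : IsBddPos (uncurry W)) :
    ∫ p : α × (ι → β), starDensity W μ ν p ∂(μ.prod (Measure.pi fun _ => ν)) = 1 := by
  have h := integral_starDensity_mul_fst (ι := ι) μ ν hW (φ := fun _ => 1) (.const one_pos)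
  simp only [mul_one] at h
  rw [h, integral_div, div_self ((hW.integral_prod_right ν).integral_pos μ).ne']

/-- Under the star density the logarithm of the degree of the centre is at least, on average, the
logarithm of the average degree. -/
theorem log_integral_le_integral_starDensity_mul_log (hW : IsBddPos (uncurry W)) :
    log (∫ x, ∫ b, W x b ∂ν ∂μ) ≤ ∫ p : α × (ι → β),
      starDensity W μ ν p * log (∫ b, W p.1 b ∂ν) ∂(μ.prod (Measure.pi fun _ => ν)) := by
  have hD := hW.integral_prod_right ν
  have hd := hD.integral_pos μ
  have hρ := hW.starDensity (ι := ι) μ ν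
  have h := hρ.integral_mul_log_le_log_integral_mul (hD.inv.comp measurable_fst)
    (μ.prod (Measure.pi fun _ => ν)) (integral_starDensity μ ν hW)
  rw [integral_starDensity_mul_fst μ ν hW hD.inv] at h
  have hx (x : α) : (∫ b, W x b ∂ν) / (∫ x, ∫ b, W x b ∂ν ∂μ) * (∫ b, W x b ∂ν)⁻¹ =
      (∫ x, ∫ b, W x b ∂ν ∂μ)⁻¹ := by
    have := (hD.pos x).ne'
    field_simp
  simp only [hx, log_inv, mul_neg, integral_neg, integral_const, probReal_univ, one_smul] at h
  linarith

/-- Jensen's inequality for the conditional law of the centre given the leaves in `S`. -/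
theorem le_integral_starDensity_mul_log_codegree (hW : IsBddPos (uncurry W))
    (S : Finset ι) :
    log (∫ x, ∫ b, W x b ∂ν ∂μ) + (S.card - 1) * ∫ p : α × (ι → β),
        starDensity W μ ν p * log (∫ b, W p.1 b ∂ν) ∂(μ.prod (Measure.pi fun _ => ν)) ≤
      ∫ p : α × (ι → β),
        starDensity W μ ν p * log (codegree W μ S p.2) ∂(μ.prod (Measure.pi fun _ => ν)) := by
  classical
  have hD := hW.integral_prod_right ν
  have hd := hD.integral_pos μ
  have hDp := hD.comp (measurable_fst (α := α) (β := ι → β))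
  have hg := (hW.codegree μ S).comp (measurable_snd (α := α) (β := ι → β))
  have hρ := hW.starDensity (ι := ι) μ ν
  set d := ∫ x, ∫ b, W x b ∂ν ∂μ with hd_def
  have hF := (((IsBddPos.const hd).mul (hDp.pow S.card)).div hDp).div hg
  have hone : ∫ p : α × (ι → β), starDensity W μ ν p *
      (d * (∫ b, W p.1 b ∂ν) ^ S.card / (∫ b, W p.1 b ∂ν) / codegree W μ S p.2)
        ∂(μ.prod (Measure.pi fun _ => ν)) = 1 := by
    have hG : IsBddPos fun p : α × (ι → β) => (∏ j ∈ S, W p.1 (p.2 j)) / codegree W μ S p.2 :=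
      (IsBddPos.prod S fun j _ => hW.edge j).div hg
    have hpt (p : α × (ι → β)) : starDensity W μ ν p *
        (d * (∫ b, W p.1 b ∂ν) ^ S.card / (∫ b, W p.1 b ∂ν) / codegree W μ S p.2) =
        (∏ i ∈ Sᶜ, W p.1 (p.2 i) / ∫ b, W p.1 b ∂ν) *
          ((∏ j ∈ S, W p.1 (p.2 j)) / codegree W μ S p.2) := by
      have h1 := (hDp.pos p).ne'
      have h2 := (hg.pos p).ne'
      rw [starDensity, ← hd_def, ← Finset.prod_compl_mul_prod S, Finset.prod_div_distrib (s := S),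
        Finset.prod_const]
      field_simp
    have hmarg (x : α) : ∫ v : ι → β, (∏ i ∈ Sᶜ, W x (v i) / ∫ b, W x b ∂ν) *
          ((∏ j ∈ S, W x (v j)) / codegree W μ S v) ∂(Measure.pi fun _ => ν) =
        ∫ v : ι → β, (∏ j ∈ S, W x (v j)) / codegree W μ S v ∂(Measure.pi fun _ => ν) := by
      have hWx : Measurable (W x) := hW.measurable.of_uncurry_left
      have h := integral_prod_compl_mul_restrict ν S (hWx.div_const _)
        (integral_div_integral_self ν hW x)
        (Φ := fun u : S → β => (∏ j, W x (u j)) / codegree W μ Finset.univ u)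
        ((by fun_prop : Measurable fun u : S → β => ∏ j, W x (u j)).div
          (hW.codegree μ Finset.univ).measurable)
      have hS (y : α) (v : ι → β) : ∏ j : S, W y (v j) = ∏ j ∈ S, W y (v j) :=
        Finset.prod_coe_sort S fun j => W y (v j)
      simpa only [codegree, Finset.restrict, hS] using h
    simp only [hpt]
    rw [integral_prod _ (((IsBddPos.prod Sᶜ fun i _ => (hW.edge i).div hDp).mul hG).integrable _)]
    simp only [hmarg]
    rw [integral_integral_swap (hG.integrable _)]
    have hv (v : ι → β) : ∫ x, (∏ j ∈ S, W x (v j)) / codegree W μ S v ∂μ = 1 := by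
      rw [integral_div]
      exact div_self ((hW.codegree μ S).pos v).ne'
    simp [hv]
  have h := hρ.integral_mul_log_le_log_integral_mul hF (μ.prod (Measure.pi fun _ => ν))
    (integral_starDensity μ ν hW)
  rw [hone, log_one] at h
  have hlog (p : α × (ι → β)) : starDensity W μ ν p *
      log (d * (∫ b, W p.1 b ∂ν) ^ S.card / (∫ b, W p.1 b ∂ν) / codegree W μ S p.2) =
      log d * starDensity W μ ν p +
        (S.card - 1) * (starDensity W μ ν p * log (∫ b, W p.1 b ∂ν)) -
        starDensity W μ ν p * log (codegree W μ S p.2) := by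
    have h1 := (hDp.pos p).ne'
    rw [log_div (by positivity) (hg.pos p).ne', log_div (by positivity) h1,
      log_mul hd.ne' (by positivity), log_pow]
    ring
  simp only [hlog] at h
  have i1 := (hρ.integrable (μ.prod (Measure.pi fun _ => ν))).const_mul (log d)
  have i2 := (hρ.integrable_mul_log hDp (μ.prod (Measure.pi fun _ => ν))).const_mul
    ((S.card : ℝ) - 1)
  rw [integral_sub (i1.fun_add i2) (hρ.integrable_mul_log hg _), integral_add i1 i2,
    integral_const_mul, integral_const_mul, integral_starDensity μ ν hW] at h
  linarith

theorem card_mul_log_le_integral_starDensity_mul_log_codegree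
    (hW : IsBddPos (uncurry W)) (S : Finset ι) :
    S.card * log (∫ x, ∫ b, W x b ∂ν ∂μ) ≤ ∫ p : α × (ι → β),
        starDensity W μ ν p * log (codegree W μ S p.2) ∂(μ.prod (Measure.pi fun _ => ν)) := by
  rcases S.eq_empty_or_nonempty with rfl | hS
  · simp [codegree]
  · have hcard : (0 : ℝ) ≤ S.card - 1 := by
      rw [sub_nonneg]
      exact_mod_cast hS.card_pos
    have h := le_integral_starDensity_mul_log_codegree μ ν hW S
    have h' := mul_le_mul_of_nonneg_left
      (log_integral_le_integral_starDensity_mul_log (ι := ι) μ ν hW) hcard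
    linarith

theorem pow_le_integral_of_isBddPos {κ : Type*} [Fintype κ] [Nonempty ι]
    (hW : IsBddPos (uncurry W)) (S : κ → Finset ι) :
    (∫ x, ∫ b, W x b ∂ν ∂μ) ^ (Fintype.card ι + ∑ t, (S t).card) ≤
      ∫ x, ∫ y : κ → α, ∫ v : ι → β, (∏ i, W x (v i)) * ∏ t, ∏ j ∈ S t, W (y t) (v j)
        ∂(Measure.pi fun _ => ν) ∂(Measure.pi fun _ => μ) ∂μ := by
  have hD := hW.integral_prod_right ν
  have hd := hD.integral_pos μ
  have hDp := hD.comp (measurable_fst (α := α) (β := ι → β))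
  have hg (t : κ) := (hW.codegree μ (S t)).comp (measurable_snd (α := α) (β := ι → β))
  have hρ := hW.starDensity (ι := ι) μ ν
  set d := ∫ x, ∫ b, W x b ∂ν ∂μ with hd_def
  set P : Measure (α × (ι → β)) := μ.prod (Measure.pi fun _ => ν)
  have hgprod : IsBddPos fun p : α × (ι → β) => ∏ t, codegree W μ (S t) p.2 :=
    .prod Finset.univ fun t _ => hg t
  have hF := (((IsBddPos.const hd).mul (hDp.pow (Fintype.card ι))).div hDp).mul hgprod
  have hstar : IsBddPos fun p : α × (ι → β) => ∏ i, W p.1 (p.2 i) :=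
    .prod Finset.univ fun i _ => hW.edge i
  have hfubini : ∫ x, ∫ y : κ → α, ∫ v : ι → β,
        (∏ i, W x (v i)) * ∏ t, ∏ j ∈ S t, W (y t) (v j)
        ∂(Measure.pi fun _ => ν) ∂(Measure.pi fun _ => μ) ∂μ =
      ∫ p, starDensity W μ ν p * (d * (∫ b, W p.1 b ∂ν) ^ Fintype.card ι / (∫ b, W p.1 b ∂ν) *
        ∏ t, codegree W μ (S t) p.2) ∂P := by
    have hpt (p : α × (ι → β)) : starDensity W μ ν p *
        (d * (∫ b, W p.1 b ∂ν) ^ Fintype.card ι / (∫ b, W p.1 b ∂ν) *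
          ∏ t, codegree W μ (S t) p.2) =
        (∏ i, W p.1 (p.2 i)) * ∏ t, codegree W μ (S t) p.2 := by
      have h1 := (hDp.pos p).ne'
      rw [starDensity, ← hd_def, Finset.prod_div_distrib, Finset.prod_const, Finset.card_univ]
      field_simp
    simp only [hpt]
    rw [integral_prod _ ((hstar.mul hgprod).integrable _)]
    refine integral_congr_ae (.of_forall fun x => ?_)
    have hyv : IsBddPos fun q : (κ → α) × (ι → β) =>
        (∏ i, W x (q.2 i)) * ∏ t, ∏ j ∈ S t, W (q.1 t) (q.2 j) :=
      (hstar.comp (φ := fun q : (κ → α) × (ι → β) => (x, q.2)) (by fun_prop)).mul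
        (.prod _ fun t _ => .prod _ fun j _ =>
          hW.comp (φ := fun q : (κ → α) × (ι → β) => (q.1 t, q.2 j)) (by fun_prop))
    simp only []
    rw [integral_integral_swap (hyv.integrable _)]
    refine integral_congr_ae (.of_forall fun v => ?_)
    simp only []
    rw [integral_const_mul, integral_fintype_prod_eq_prod fun t y => ∏ j ∈ S t, W y (v j)]
    rfl
  have h := hρ.integral_mul_log_le_log_integral_mul hF P (integral_starDensity μ ν hW)
  have hlog (p : α × (ι → β)) : starDensity W μ ν p *
      log (d * (∫ b, W p.1 b ∂ν) ^ Fintype.card ι / (∫ b, W p.1 b ∂ν) *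
        ∏ t, codegree W μ (S t) p.2) =
      log d * starDensity W μ ν p +
        (Fintype.card ι - 1) * (starDensity W μ ν p * log (∫ b, W p.1 b ∂ν)) +
        ∑ t, starDensity W μ ν p * log (codegree W μ (S t) p.2) := by
    have h1 := (hDp.pos p).ne'
    rw [log_mul (by positivity) (hgprod.pos p).ne', log_div (by positivity) h1,
      log_mul hd.ne' (by positivity), log_pow, log_prod fun t _ => ((hg t).pos p).ne',
      ← Finset.mul_sum]
    ring
  have i1 := (hρ.integrable P).const_mul (log d)
  have i2 := (hρ.integrable_mul_log hDp P).const_mul ((Fintype.card ι : ℝ) - 1)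
  have i3 (t : κ) := hρ.integrable_mul_log (hg t) P
  simp only [hlog] at h
  rw [integral_add (i1.fun_add i2) (integrable_finsetSum _ fun t _ => i3 t), integral_add i1 i2,
    integral_finsetSum _ fun t _ => i3 t,
    integral_const_mul, integral_const_mul, integral_starDensity μ ν hW] at h
  have hcard : (0 : ℝ) ≤ Fintype.card ι - 1 := by
    rw [sub_nonneg]
    exact_mod_cast Fintype.card_pos
  have hL := mul_le_mul_of_nonneg_left
    (log_integral_le_integral_starDensity_mul_log (ι := ι) μ ν hW) hcard
  have hsum := Finset.sum_le_sum fun t (_ : t ∈ Finset.univ) =>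
    card_mul_log_le_integral_starDensity_mul_log_codegree μ ν hW (S t)
  rw [← Finset.sum_mul] at hsum
  rw [hfubini, ← log_le_log_iff (pow_pos hd _) ((hρ.mul hF).integral_pos P), log_pow]
  push_cast
  linarith

/-- The weighted count of a bipartite graph with a vertex complete to the other side is at least
the edge density raised to the number of edges. -/
theorem pow_le_integral_of_nonneg {κ : Type*} [Fintype κ] (hmeas : Measurable (uncurry W))
    (hnonneg : ∀ x b, 0 ≤ W x b) {C : ℝ} (hC : ∀ x b, W x b ≤ C) (S : κ → Finset ι) :
    (∫ x, ∫ b, W x b ∂ν ∂μ) ^ (Fintype.card ι + ∑ t, (S t).card) ≤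
      ∫ x, ∫ y : κ → α, ∫ v : ι → β, (∏ i, W x (v i)) * ∏ t, ∏ j ∈ S t, W (y t) (v j)
        ∂(Measure.pi fun _ => ν) ∂(Measure.pi fun _ => μ) ∂μ := by
  rcases isEmpty_or_nonempty ι with hι | hι
  · simp [Finset.eq_empty_of_isEmpty]
  have hpos {ε : ℝ} (hε : 0 < ε) : IsBddPos (uncurry fun x b => W x b + ε) :=
    ⟨hmeas.add_const ε, ε, C + ε, hε, fun p =>
      ⟨le_add_of_nonneg_left (hnonneg p.1 p.2), add_le_add_left (hC p.1 p.2) ε⟩⟩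
  let G (ε : ℝ) (z : α × (κ → α) × (ι → β)) : ℝ :=
    (∏ i, (W z.1 (z.2.2 i) + ε)) * ∏ t, ∏ j ∈ S t, (W (z.2.1 t) (z.2.2 j) + ε)
  have hG_one : IsBddPos (G 1) :=
    (IsBddPos.prod _ fun i _ => (hpos one_pos).comp
      (φ := fun z : α × (κ → α) × (ι → β) => (z.1, z.2.2 i)) (by fun_prop)).mul
    (.prod _ fun t _ => .prod _ fun j _ => (hpos one_pos).comp
      (φ := fun z : α × (κ → α) × (ι → β) => (z.2.1 t, z.2.2 j)) (by fun_prop))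
  have hG_meas (ε : ℝ) : Measurable (G ε) := by
    have h1 (i : ι) : Measurable fun z : α × (κ → α) × (ι → β) => W z.1 (z.2.2 i) :=
      hmeas.comp (f := fun z : α × (κ → α) × (ι → β) => (z.1, z.2.2 i)) (by fun_prop)
    have h2 (t : κ) (j : ι) : Measurable fun z : α × (κ → α) × (ι → β) => W (z.2.1 t) (z.2.2 j) :=
      hmeas.comp (f := fun z : α × (κ → α) × (ι → β) => (z.2.1 t, z.2.2 j)) (by fun_prop)
    fun_prop
  have hG_le {ε : ℝ} (h0 : 0 ≤ ε) (h1 : ε ≤ 1) (z) : ‖G ε z‖ ≤ G 1 z := by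
    have hW0 (x b) : 0 ≤ W x b + ε := add_nonneg (hnonneg x b) h0
    have hW1 (x b) : W x b + ε ≤ W x b + 1 := by linarith
    rw [Real.norm_of_nonneg (mul_nonneg (Finset.prod_nonneg fun _ _ => hW0 _ _)
      (Finset.prod_nonneg fun _ _ => Finset.prod_nonneg fun _ _ => hW0 _ _))]
    exact mul_le_mul (Finset.prod_le_prod (fun _ _ => hW0 _ _) fun _ _ => hW1 _ _)
      (Finset.prod_le_prod (fun _ _ => Finset.prod_nonneg fun _ _ => hW0 _ _) fun _ _ =>
        Finset.prod_le_prod (fun _ _ => hW0 _ _) fun _ _ => hW1 _ _)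
      (Finset.prod_nonneg fun _ _ => Finset.prod_nonneg fun _ _ => hW0 _ _)
      (Finset.prod_nonneg fun _ _ => (hW0 _ _).trans (hW1 _ _))
  let P : Measure (α × (κ → α) × (ι → β)) :=
    μ.prod ((Measure.pi fun _ => μ).prod (Measure.pi fun _ => ν))
  have hG_iter {ε : ℝ} (h0 : 0 ≤ ε) (h1 : ε ≤ 1) : ∫ z, G ε z ∂P =
      ∫ x, ∫ y, ∫ v, G ε (x, y, v) ∂(Measure.pi fun _ => ν) ∂(Measure.pi fun _ => μ) ∂μ := by
    rw [integral_prod _ ((hG_one.integrable P).mono' (hG_meas ε).aestronglyMeasurable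
      (.of_forall (hG_le h0 h1)))]
    refine integral_congr_ae (.of_forall fun x => integral_prod _ ?_)
    exact ((hG_one.comp measurable_prodMk_left).integrable _).mono'
      ((hG_meas ε).comp measurable_prodMk_left).aestronglyMeasurable
      (.of_forall fun q => hG_le h0 h1 (x, q))
  let u (n : ℕ) : ℝ := 1 / ((n : ℝ) + 1)
  have hu_pos (n : ℕ) : 0 < u n := Nat.one_div_pos_of_nat
  have hu_le (n : ℕ) : u n ≤ 1 := by
    simpa [u] using Nat.one_div_le_one_div (α := ℝ) n.zero_le
  have hu : Filter.Tendsto u Filter.atTop (nhds 0) := tendsto_one_div_add_atTop_nhds_zero_nat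
  have hlim : Filter.Tendsto (fun n => ∫ z, G (u n) z ∂P) Filter.atTop (nhds (∫ z, G 0 z ∂P)) := by
    refine tendsto_integral_of_dominated_convergence (G 1)
      (fun n => (hG_meas _).aestronglyMeasurable) (hG_one.integrable P)
      (fun n => .of_forall (hG_le (hu_pos n).le (hu_le n))) (.of_forall fun z => ?_)
    have hcont : Continuous fun ε => G ε z := by fun_prop
    exact (hcont.tendsto 0).comp hu
  have hW1 (x : α) : Integrable (W x) ν :=
    .of_bound hmeas.of_uncurry_left.aestronglyMeasurable C
      (.of_forall fun b => (Real.norm_of_nonneg (hnonneg x b)).trans_le (hC x b))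
  have hedge (ε : ℝ) : ∫ x, ∫ b, (W x b + ε) ∂ν ∂μ = (∫ x, ∫ b, W x b ∂ν ∂μ) + ε := by
    have hWp : Integrable (uncurry W) (μ.prod ν) := .of_bound hmeas.aestronglyMeasurable C
      (.of_forall fun p => (Real.norm_of_nonneg (hnonneg p.1 p.2)).trans_le (hC p.1 p.2))
    simp only [integral_add (hW1 _) (integrable_const ε), integral_const, probReal_univ, one_smul]
    have hdeg : Integrable (fun x => ∫ b, W x b ∂ν) μ := hWp.integral_prod_left
    rw [integral_add hdeg (integrable_const ε)]
    simp
  have hlim' : Filter.Tendsto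
      (fun n => ((∫ x, ∫ b, W x b ∂ν ∂μ) + u n) ^ (Fintype.card ι + ∑ t, (S t).card))
      Filter.atTop (nhds ((∫ x, ∫ b, W x b ∂ν ∂μ) ^ (Fintype.card ι + ∑ t, (S t).card))) := by
    simpa using (hu.const_add _).pow _
  have h := le_of_tendsto_of_tendsto' hlim' hlim fun n => by
    rw [hG_iter (hu_pos n).le (hu_le n), ← hedge]
    exact pow_le_integral_of_isBddPos μ ν (hpos (hu_pos n)) S
  rw [hG_iter le_rfl zero_le_one] at h
  simpa only [G, add_zero] using h

end Star

/-- Sidorenko's conjecture for bipartite graphs with one vertex complete to the other side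
(Conlon–Fox–Sudakov): `H` has vertices `x, y₁,…,y_m, v₁,…,v_k`, with `x` joined to all the
`vᵢ` and `y_t` joined to `S_t ⊆ {v₁,…,v_k}`, `|S_t| = a_t`.  With `e = k + Σ_t a_t`,
for every bounded symmetric measurable `W : [0,1]² → ℝ≥0` with `d = ∫∫ W`, one has
`t(H, W) ≥ d^e`. -/
theorem conlon_fox_sudakov (m k : ℕ) (S : Fin m → Finset (Fin k)) (a : Fin m → ℕ)
    (ha : ∀ t, (S t).card = a t)
    (W : I → I → ℝ)
    (hmeas : Measurable (Function.uncurry W))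
    (hnonneg : ∀ x y, 0 ≤ W x y)
    (hbdd : ∃ C : ℝ, ∀ x y, W x y ≤ C)
    (hsym : ∀ x y, W x y = W y x)
    (d : ℝ) (hd : d = ∫ x : I, ∫ y : I, W x y) :
    (∫ x : I, ∫ y : Fin m → I, ∫ v : Fin k → I,
        (∏ i : Fin k, W x (v i)) * ∏ t : Fin m, ∏ j ∈ S t, W (y t) (v j))
      ≥ d ^ (k + ∑ t : Fin m, a t) := by
  obtain ⟨C, hC⟩ := hbdd
  simpa only [hd, ha, Fintype.card_fin, volume_pi, ge_iff_le] using
    pow_le_integral_of_nonneg volume volume hmeas hnonneg hC S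
end

section
/- Call a bipartite graph H Sidorenko if t(H, W) ≥ (∫∫ W)^{|E(H)|} for every bounded symmetric measurable W : [0,1]² → ℝ≥0. If H₁, H₂ are Sidorenko graphs with distinguished edges e₁ ∈ E(H₁), e₂ ∈ E(H₂), then the graph H obtained by identifying e₁ with e₂ (gluing H₁ and H₂ along an edge) is also Sidorenko. -/
open MeasureTheory Real unitInterval

open scoped Classical in
/-- A bipartite graph `H` is Sidorenko if `t(H, W) ≥ (∫∫ W)^{|E(H)|}` for every bounded
symmetric measurable `W : [0,1]² → ℝ≥0`. -/
def IsSidorenko {V : Type} [Fintype V] [DecidableEq V] (H : SimpleGraph V) : Prop :=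
  ∀ (W : I → I → ℝ), Measurable (Function.uncurry W) → (∀ x y, 0 ≤ W x y) →
    (∃ C : ℝ, ∀ x y, W x y ≤ C) → ∀ (hsym : ∀ x y, W x y = W y x),
    (∫ x : V → I, ∏ e ∈ H.edgeFinset,
        Sym2.lift ⟨fun a b => W (x a) (x b), fun a b => hsym (x a) (x b)⟩ e)
      ≥ (∫ u : I, ∫ v : I, W u v) ^ H.edgeFinset.card

namespace Sidorenko

/-- The density of homomorphisms from the graph on `V` with edge set `E` to the finite weighted
graph `w`. -/
noncomputable def homDensity {V A : Type*} [Fintype V] [DecidableEq V] [Fintype A]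
    (E : Finset (Sym2 V)) (w : Sym2 A → ℝ) : ℝ :=
  (∑ x : V → A, ∏ e ∈ E, w (e.map x)) / (Fintype.card A : ℝ) ^ Fintype.card V

/-- The edge density of a finite weighted graph. -/
noncomputable def edgeDensity {A : Type*} [Fintype A] (w : Sym2 A → ℝ) : ℝ :=
  (∑ p : A × A, w s(p.1, p.2)) / (Fintype.card A : ℝ) ^ 2

/-- The Sidorenko property tested on finite weighted graphs. -/
def IsFinSidorenko {V : Type*} [Fintype V] [DecidableEq V] (E : Finset (Sym2 V)) : Prop :=
  ∀ (A : Type) [Fintype A] [Nonempty A] (w : Sym2 A → ℝ), (∀ z, 0 ≤ w z) →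
    edgeDensity w ^ E.card ≤ homDensity E w

section Gluing

variable {V₁ V₂ V A : Type*} [Fintype V₁] [Fintype V₂] [Fintype V] [DecidableEq V]

/-- Maps out of a union of two overlapping images are pairs of maps that agree on the overlap. -/
theorem sum_mul_comp_eq {i₁ : V₁ → V} {i₂ : V₂ → V} {a₁ b₁ : V₁} {a₂ b₂ : V₂}
    (hinj₁ : Function.Injective i₁) (hinj₂ : Function.Injective i₂)
    (hcover : ∀ v : V, (∃ u, i₁ u = v) ∨ (∃ u, i₂ u = v))
    (ha : i₁ a₁ = i₂ a₂) (hb : i₁ b₁ = i₂ b₂)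
    (hmeet : ∀ u₁ u₂, i₁ u₁ = i₂ u₂ → (u₁ = a₁ ∧ u₂ = a₂) ∨ (u₁ = b₁ ∧ u₂ = b₂))
    [Fintype A] [DecidableEq A] [DecidableEq V₁] [DecidableEq V₂]
    (F₁ : (V₁ → A) → ℝ) (F₂ : (V₂ → A) → ℝ) :
    ∑ x : V → A, F₁ (x ∘ i₁) * F₂ (x ∘ i₂) =
      ∑ x₁ : V₁ → A, F₁ x₁ * ∑ x₂ : V₂ → A with x₂ a₂ = x₁ a₁ ∧ x₂ b₂ = x₁ b₁, F₂ x₂ := by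
  classical
  simp_rw [Finset.mul_sum]
  rw [Finset.sum_sigma']
  refine Finset.sum_bij (fun x _ => ⟨x ∘ i₁, x ∘ i₂⟩) ?_ ?_ ?_ ?_
  · intro x _
    simp [ha, hb]
  · intro x _ y _ h
    obtain ⟨h₁, h₂⟩ := Sigma.mk.inj_iff.1 h
    have h₂ := eq_of_heq h₂
    funext v
    rcases hcover v with ⟨u, rfl⟩ | ⟨u, rfl⟩
    · exact congrFun h₁ u
    · exact congrFun h₂ u
  · rintro ⟨x₁, x₂⟩ h
    simp only [Finset.mem_sigma, Finset.mem_univ, Finset.mem_filter, true_and] at h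
    let x : V → A := fun v => if h : ∃ u, i₁ u = v then x₁ h.choose else
      x₂ ((hcover v).resolve_left h).choose
    have hx₁ : x ∘ i₁ = x₁ := by
      funext u
      have hu : ∃ u', i₁ u' = i₁ u := ⟨u, rfl⟩
      simp only [x, Function.comp, dif_pos hu]
      exact congrArg x₁ (hinj₁ hu.choose_spec)
    have hx₂ : x ∘ i₂ = x₂ := by
      funext u
      by_cases hu : ∃ u', i₁ u' = i₂ u
      · obtain ⟨u', hu'⟩ := hu
        have := congrFun hx₁ u'
        simp only [Function.comp] at this ⊢
        rw [← hu', this]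
        rcases hmeet _ _ hu' with ⟨rfl, rfl⟩ | ⟨rfl, rfl⟩
        · exact h.1.symm
        · exact h.2.symm
      · simp only [x, Function.comp, dif_neg hu]
        exact congrArg x₂ (hinj₂ ((hcover (i₂ u)).resolve_left hu).choose_spec)
    exact ⟨x, Finset.mem_univ _, by rw [hx₁, hx₂]⟩
  · intro x _
    rfl

theorem card_add_two {i₁ : V₁ → V} {i₂ : V₂ → V} {a₁ b₁ : V₁} {a₂ b₂ : V₂} (hab : a₁ ≠ b₁)
    (hinj₁ : Function.Injective i₁) (hinj₂ : Function.Injective i₂)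
    (hcover : ∀ v : V, (∃ u, i₁ u = v) ∨ (∃ u, i₂ u = v))
    (ha : i₁ a₁ = i₂ a₂) (hb : i₁ b₁ = i₂ b₂)
    (hmeet : ∀ u₁ u₂, i₁ u₁ = i₂ u₂ → (u₁ = a₁ ∧ u₂ = a₂) ∨ (u₁ = b₁ ∧ u₂ = b₂)) :
    Fintype.card V + 2 = Fintype.card V₁ + Fintype.card V₂ := by
  have hu : Finset.univ.image i₁ ∪ Finset.univ.image i₂ = Finset.univ := by
    ext v
    simpa using hcover v
  have hi : Finset.univ.image i₁ ∩ Finset.univ.image i₂ = {i₁ a₁, i₁ b₁} := by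
    ext v
    simp only [Finset.mem_inter, Finset.mem_image, Finset.mem_univ, true_and, Finset.mem_insert,
      Finset.mem_singleton]
    constructor
    · rintro ⟨⟨u₁, rfl⟩, u₂, h⟩
      rcases hmeet _ _ h.symm with ⟨rfl, -⟩ | ⟨rfl, -⟩ <;> simp
    · rintro (rfl | rfl)
      · exact ⟨⟨_, rfl⟩, _, ha.symm⟩
      · exact ⟨⟨_, rfl⟩, _, hb.symm⟩
  have := Finset.card_union_add_card_inter (Finset.univ.image i₁) (Finset.univ.image i₂)
  rwa [hu, hi, Finset.card_pair (hinj₁.ne hab), Finset.card_image_of_injective _ hinj₁,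
    Finset.card_image_of_injective _ hinj₂, Finset.card_univ, Finset.card_univ,
    Finset.card_univ] at this

/-- In an edge-transitive weighted graph, gluing along an edge multiplies homomorphism densities,
up to the edge density. -/
theorem homDensity_mul_edgeDensity [DecidableEq V₁] [DecidableEq V₂] [Fintype A] [Nonempty A]
    {i₁ : V₁ → V} {i₂ : V₂ → V} {a₁ b₁ : V₁} {a₂ b₂ : V₂} (hab : a₁ ≠ b₁)
    (hinj₁ : Function.Injective i₁) (hinj₂ : Function.Injective i₂)
    (hcover : ∀ v : V, (∃ u, i₁ u = v) ∨ (∃ u, i₂ u = v))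
    (ha : i₁ a₁ = i₂ a₂) (hb : i₁ b₁ = i₂ b₂)
    (hmeet : ∀ u₁ u₂, i₁ u₁ = i₂ u₂ → (u₁ = a₁ ∧ u₂ = a₂) ∨ (u₁ = b₁ ∧ u₂ = b₂))
    {E₁ : Finset (Sym2 V₁)} {E₂ : Finset (Sym2 V₂)} {E : Finset (Sym2 V)}
    (he₁ : s(a₁, b₁) ∈ E₁) (he₂ : s(a₂, b₂) ∈ E₂)
    (hE : E = E₁.image (Sym2.map i₁) ∪ (E₂.erase s(a₂, b₂)).image (Sym2.map i₂))
    (hdisj : Disjoint (E₁.image (Sym2.map i₁)) ((E₂.erase s(a₂, b₂)).image (Sym2.map i₂)))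
    (w : Sym2 A → ℝ)
    (htrans : ∀ p q p' q', w s(p, q) ≠ 0 → w s(p', q') ≠ 0 →
      ∃ τ : Equiv.Perm A, (∀ z, w (z.map τ) = w z) ∧ τ p = p' ∧ τ q = q') :
    homDensity E w * edgeDensity w = homDensity E₁ w * homDensity E₂ w := by
  classical
  let F₁ : (V₁ → A) → ℝ := fun x => ∏ e ∈ E₁, w (e.map x)
  let F₂ : (V₂ → A) → ℝ := fun x => ∏ e ∈ E₂.erase s(a₂, b₂), w (e.map x)
  let G : A → A → ℝ := fun p q => ∑ x₂ : V₂ → A with x₂ a₂ = p ∧ x₂ b₂ = q, F₂ x₂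
  have hG : ∃ c, ∀ p q, w s(p, q) ≠ 0 → G p q = c := by
    by_cases h : ∃ p q, w s(p, q) ≠ 0
    · obtain ⟨p, q, hpq⟩ := h
      refine ⟨G p q, fun p' q' h' => ?_⟩
      obtain ⟨τ, hτ, rfl, rfl⟩ := htrans _ _ _ _ hpq h'
      symm
      refine Finset.sum_equiv (Equiv.arrowCongr (Equiv.refl V₂) τ) ?_ ?_
      · intro x
        simp
      · intro x _
        refine Finset.prod_congr rfl fun e _ => ?_
        rw [← hτ, Sym2.map_map]
        rfl
    · push Not at h
      exact ⟨0, fun p q hpq => absurd (h p q) hpq⟩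
  obtain ⟨c, hc⟩ := hG
  have hF₁ (x : V₁ → A) (h : w s(x a₁, x b₁) = 0) : F₁ x = 0 :=
    Finset.prod_eq_zero he₁ h
  have hH : ∑ x : V → A, ∏ e ∈ E, w (e.map x) = (∑ x, F₁ x) * c := by
    have h (x : V → A) : ∏ e ∈ E, w (e.map x) = F₁ (x ∘ i₁) * F₂ (x ∘ i₂) := by
      rw [hE, Finset.prod_union hdisj, Finset.prod_image (Sym2.map.injective hinj₁).injOn,
        Finset.prod_image (Sym2.map.injective hinj₂).injOn]
      simp only [F₁, F₂, Sym2.map_map]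
    simp_rw [h]
    rw [sum_mul_comp_eq hinj₁ hinj₂ hcover ha hb hmeet, Finset.sum_mul]
    refine Finset.sum_congr rfl fun x _ => ?_
    by_cases hx : w s(x a₁, x b₁) = 0
    · rw [hF₁ x hx, zero_mul, zero_mul]
    · exact congrArg _ (hc _ _ hx)
  have hH₂ : ∑ x : V₂ → A, ∏ e ∈ E₂, w (e.map x) = (∑ p : A × A, w s(p.1, p.2)) * c := by
    rw [← Finset.sum_fiberwise Finset.univ (fun x : V₂ → A => (x a₂, x b₂)), Finset.sum_mul]
    refine Finset.sum_congr rfl fun p _ => ?_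
    have : w s(p.1, p.2) * G p.1 p.2 = w s(p.1, p.2) * c := by
      by_cases hx : w s(p.1, p.2) = 0
      · simp [hx]
      · rw [hc _ _ hx]
    rw [← this, Finset.mul_sum]
    simp only [Prod.ext_iff]
    refine Finset.sum_congr rfl fun x hx => ?_
    rw [← Finset.mul_prod_erase _ _ he₂]
    simp only [Finset.mem_filter] at hx
    rw [Sym2.map_mk, hx.2.1, hx.2.2]
  have hA : (Fintype.card A : ℝ) ≠ 0 := by simp
  have hcard := card_add_two hab hinj₁ hinj₂ hcover ha hb hmeet
  unfold homDensity edgeDensity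
  rw [hH, hH₂, div_mul_div_comm, div_mul_div_comm, ← pow_add, ← pow_add, hcard]
  ring

end Gluing

section Tensor

variable {A ι : Type*} [Fintype ι]

/-- The tensor power of a weighted graph. -/
def tensorPow (ι : Type*) [Fintype ι] (w : Sym2 A → ℝ) (z : Sym2 (ι → A)) : ℝ :=
  ∏ i, w (z.map (· i))

theorem homDensity_tensorPow [Fintype A] {V : Type*} [Fintype V] [DecidableEq V] [DecidableEq ι]
    (E : Finset (Sym2 V)) (w : Sym2 A → ℝ) :
    homDensity E (tensorPow ι w) = homDensity E w ^ Fintype.card ι := by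
  classical
  have h : ∑ x : V → ι → A, ∏ e ∈ E, tensorPow ι w (e.map x) =
      (∑ x : V → A, ∏ e ∈ E, w (e.map x)) ^ Fintype.card ι := by
    rw [← Finset.card_univ, ← Finset.prod_const, Fintype.prod_sum]
    refine Fintype.sum_equiv (Equiv.piComm _) _ _ fun x => ?_
    simp only [tensorPow, Sym2.map_map]
    rw [Finset.prod_comm]
    rfl
  unfold homDensity
  rw [h, div_pow, Fintype.card_fun, Nat.cast_pow, ← pow_mul, ← pow_mul, mul_comm]

/-- The number of occurrences of each pair of values in a pair of words. -/
def pairCount [DecidableEq A] (x y : ι → A) (c : A × A) : ℕ :=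
  Fintype.card {i // (x i, y i) = c}

theorem pairCount_swap [DecidableEq A] (x y : ι → A) (c : A × A) :
    pairCount y x c.swap = pairCount x y c := by
  refine Fintype.card_congr (Equiv.subtypeEquivRight fun i => ?_)
  simp [Prod.ext_iff, and_comm]

theorem pairCount_comp [DecidableEq A] (x y : ι → A) (τ : Equiv.Perm ι) :
    pairCount (x ∘ τ) (y ∘ τ) = pairCount x y := by
  funext c
  exact Fintype.card_congr (τ.subtypeEquiv fun i => Iff.rfl)

theorem pairCount_sumElim [DecidableEq A] {κ : Type*} [Fintype κ] (x y : ι → A) (x' y' : κ → A)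
    (c : A × A) :
    pairCount (Sum.elim x x') (Sum.elim y y') c = pairCount x y c + pairCount x' y' c := by
  unfold pairCount
  simp only [Fintype.card_subtype, Finset.card_filter, Fintype.sum_sum_type, Sum.elim_inl,
    Sum.elim_inr]
  congr!

theorem exists_perm_of_pairCount_eq [DecidableEq A] {x y x' y' : ι → A}
    (h : pairCount x y = pairCount x' y') :
    ∃ τ : Equiv.Perm ι, x ∘ τ = x' ∧ y ∘ τ = y' := by
  have e (c : A × A) : {i // (x' i, y' i) = c} ≃ {i // (x i, y i) = c} :=
    Fintype.equivOfCardEq (congrFun h c).symm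
  have hτ (i : ι) := Prod.ext_iff.1 (Equiv.ofFiberEquiv_map e i)
  exact ⟨Equiv.ofFiberEquiv e, funext fun i => (hτ i).1, funext fun i => (hτ i).2⟩

open scoped Classical in
/-- The restriction of a tensor power to the pairs of words of a given joint type. -/
noncomputable def typeClass (w : Sym2 A → ℝ) (M : A × A → ℕ) (z : Sym2 (ι → A)) : ℝ :=
  if ∃ x y, z = s(x, y) ∧ pairCount x y = M then tensorPow ι w z else 0

theorem typeClass_nonneg {w : Sym2 A → ℝ} (hw : ∀ z, 0 ≤ w z) (M : A × A → ℕ)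
    (z : Sym2 (ι → A)) : 0 ≤ typeClass w M z := by
  unfold typeClass
  split_ifs
  · exact Finset.prod_nonneg fun _ _ => hw _
  · exact le_rfl

theorem typeClass_le {w : Sym2 A → ℝ} (hw : ∀ z, 0 ≤ w z) (M : A × A → ℕ)
    (z : Sym2 (ι → A)) : typeClass w M z ≤ tensorPow ι w z := by
  unfold typeClass
  split_ifs
  · exact le_rfl
  · exact Finset.prod_nonneg fun _ _ => hw _

theorem typeClass_mk [Fintype A] [DecidableEq A] (w : Sym2 A → ℝ) {M : A × A → ℕ}
    (hM : ∀ c, M c.swap = M c) (x y : ι → A) :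
    typeClass w M s(x, y) = if pairCount x y = M then tensorPow ι w s(x, y) else 0 := by
  unfold typeClass
  congr 1
  refine propext ⟨?_, fun h => ⟨x, y, rfl, by convert h⟩⟩
  rintro ⟨x', y', h, hM'⟩
  rcases Sym2.eq_iff.1 h with ⟨rfl, rfl⟩ | ⟨rfl, rfl⟩
  · convert hM'
  · funext c
    rw [← pairCount_swap, ← hM c, ← hM']
    congr!

theorem typeClass_trans [Fintype A] (w : Sym2 A → ℝ) {M : A × A → ℕ} (hM : ∀ c, M c.swap = M c)
    (p q p' q' : ι → A) (h : typeClass w M s(p, q) ≠ 0) (h' : typeClass w M s(p', q') ≠ 0) :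
    ∃ τ : Equiv.Perm (ι → A), (∀ z, typeClass w M (z.map τ) = typeClass w M z) ∧
      τ p = p' ∧ τ q = q' := by
  classical
  rw [typeClass_mk w hM] at h h'
  have hp := (ite_ne_right_iff.1 h).1
  have hp' := (ite_ne_right_iff.1 h').1
  obtain ⟨τ, hτ, hτ'⟩ := exists_perm_of_pairCount_eq (hp.trans hp'.symm)
  refine ⟨Equiv.arrowCongr τ.symm (Equiv.refl A), fun z => ?_, hτ, hτ'⟩
  induction z with | _ x y
  rw [Sym2.map_mk, typeClass_mk w hM, typeClass_mk w hM]
  change (if pairCount (x ∘ τ) (y ∘ τ) = M then tensorPow ι w s(x ∘ τ, y ∘ τ) else 0) = _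
  rw [pairCount_comp]
  congr 1
  exact Equiv.prod_comp τ fun i => w s(x i, y i)

/-- Some symmetric type class of an even tensor power carries all but a polynomial factor of the
edge weight. -/
theorem exists_typeClass [Fintype A] [DecidableEq A] {w : Sym2 A → ℝ} (hw : ∀ z, 0 ≤ w z) (n : ℕ) :
    ∃ M : A × A → ℕ, (∀ c, M c.swap = M c) ∧
      edgeDensity w ^ (2 * n) ≤ edgeDensity (typeClass (ι := Fin n ⊕ Fin n) w M) *
        ((n : ℝ) + 1) ^ (2 * Fintype.card (A × A)) := by
  let P : (Fin n → A) × (Fin n → A) → ℝ := fun p => tensorPow (Fin n) w s(p.1, p.2)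
  have hP (p) : 0 ≤ P p := Finset.prod_nonneg fun _ _ => hw _
  let S : ℝ := ∑ p : A × A, w s(p.1, p.2)
  have hS : 0 ≤ S := Finset.sum_nonneg fun _ _ => hw _
  have hsum : ∑ p, P p = S ^ n := by
    have h : S ^ n = ∏ _i : Fin n, ∑ p : A × A, w s(p.1, p.2) := by simp [S]
    rw [h, Fintype.prod_sum]
    exact Fintype.sum_equiv (Equiv.arrowProdEquivProdArrow (Fin n) (fun _ => A) (fun _ => A)).symm
      _ _ fun p => rfl
  let cnt : (Fin n → A) × (Fin n → A) → A × A → Fin (n + 1) := fun p c =>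
    ⟨pairCount p.1 p.2 c, Nat.lt_succ_of_le <| by
      simpa [pairCount] using Fintype.card_subtype_le fun i => (p.1 i, p.2 i) = c⟩
  let D : ℝ := ((n : ℝ) + 1) ^ Fintype.card (A × A)
  have hD : 0 < D := by positivity
  obtain ⟨N, hN⟩ : ∃ N, S ^ n / D ≤ ∑ p with cnt p = N, P p := by
    refine Fintype.exists_le_sum_fiber_of_nsmul_le_sum cnt ?_
    rw [hsum, Fintype.card_fun, Fintype.card_fin, nsmul_eq_mul]
    push_cast
    rw [mul_div_cancel₀ _ hD.ne']
  let M : A × A → ℕ := fun c => N c + N c.swap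
  have hM (c : A × A) : M c.swap = M c := by simp [M, add_comm]
  refine ⟨M, hM, ?_⟩
  let T := ∑ p with cnt p = N, P p
  have hT : T * T ≤ ∑ p : (Fin n ⊕ Fin n → A) × (Fin n ⊕ Fin n → A),
      typeClass w M s(p.1, p.2) := by
    let f : ((Fin n → A) × (Fin n → A)) × ((Fin n → A) × (Fin n → A)) →
        (Fin n ⊕ Fin n → A) × (Fin n ⊕ Fin n → A) := fun p =>
      (Sum.elim p.1.1 p.2.2, Sum.elim p.1.2 p.2.1)
    have hf : Function.Injective f := by
      rintro ⟨⟨x, y⟩, x', y'⟩ ⟨⟨u, v⟩, u', v'⟩ h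
      obtain ⟨h₁, h₂⟩ := Prod.ext_iff.1 h
      obtain ⟨rfl, rfl⟩ := Sum.elim_eq_iff.1 h₁
      obtain ⟨rfl, rfl⟩ := Sum.elim_eq_iff.1 h₂
      rfl
    rw [Finset.sum_mul_sum, ← Finset.sum_product']
    refine le_trans (le_of_eq ?_) (Finset.sum_le_sum_of_subset_of_nonneg
      (Finset.subset_univ ((Finset.univ.filter (cnt · = N) ×ˢ
        Finset.univ.filter (cnt · = N)).image f)) fun p _ _ => typeClass_nonneg hw M _)
    rw [Finset.sum_image hf.injOn]
    refine Finset.sum_congr rfl ?_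
    rintro ⟨p, q⟩ hpq
    simp only [Finset.mem_product, Finset.mem_filter, Finset.mem_univ, true_and] at hpq
    rw [typeClass_mk w hM, if_pos]
    · simp only [P, f, tensorPow, Fintype.prod_sum_type, Sym2.map_mk, Sum.elim_inl, Sum.elim_inr]
      congr 2
      funext i
      rw [Sym2.eq_swap]
    · funext c
      rw [pairCount_sumElim, ← pairCount_swap q.2]
      have h₁ := congrArg Fin.val (congrFun hpq.1 c)
      have h₂ := congrArg Fin.val (congrFun hpq.2 c.swap)
      exact congrArg₂ _ h₁ h₂
  have hSD : 0 ≤ S ^ n / D := by positivity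
  have hfin : S ^ (2 * n) ≤ (∑ p : (Fin n ⊕ Fin n → A) × (Fin n ⊕ Fin n → A),
      typeClass w M s(p.1, p.2)) * D ^ 2 := by
    have := (mul_le_mul hN hN hSD (hSD.trans hN)).trans hT
    rw [div_mul_div_comm, div_le_iff₀ (by positivity)] at this
    calc S ^ (2 * n) = S ^ n * S ^ n := by ring
      _ ≤ _ := this
      _ = _ := by ring
  unfold edgeDensity
  have hc : ((Fintype.card (Fin n ⊕ Fin n → A) : ℝ)) ^ 2 =
      ((Fintype.card A : ℝ) ^ 2) ^ (2 * n) := by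
    rw [Fintype.card_fun, Fintype.card_sum, Fintype.card_fin]
    push_cast
    ring
  have hD2 : ((n : ℝ) + 1) ^ (2 * Fintype.card (A × A)) = D ^ 2 := by
    rw [mul_comm, pow_mul]
  rw [hc, hD2, div_pow, div_mul_eq_mul_div]
  gcongr

end Tensor

theorem le_of_forall_pow_le {a b : ℝ} (ha : 0 ≤ a) (k : ℕ)
    (h : ∀ n : ℕ, b ^ n ≤ a ^ n * ((n : ℝ) + 1) ^ k) : b ≤ a := by
  by_contra! hab
  have hb' : 0 < b := ha.trans_lt hab
  have hr0 : 0 ≤ a / b := by positivity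
  have hr1 : a / b < 1 := (div_lt_one hb').2 hab
  have h1 (n : ℕ) : 1 ≤ (a / b) ^ n * ((n : ℝ) + 1) ^ k := by
    rw [div_pow, div_mul_eq_mul_div, one_le_div (by positivity)]
    exact h n
  have ht := (tendsto_pow_const_mul_const_pow_of_abs_lt_one k
    (by rwa [abs_of_nonneg hr0] : |a / b| < 1)).comp (Filter.tendsto_add_atTop_nat 1)
  have hle : a / b ≤ 0 := by
    refine ge_of_tendsto' ht fun n => ?_
    have := mul_le_mul_of_nonneg_left (h1 n) hr0
    calc a / b = a / b * 1 := (mul_one _).symm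
      _ ≤ _ := this
      _ = _ := by simp only [Function.comp]; push_cast; ring
  have := h1 1
  rw [le_antisymm hle hr0] at this
  norm_num at this

theorem homDensity_mono {V A : Type*} [Fintype V] [DecidableEq V] [Fintype A]
    (E : Finset (Sym2 V)) {w w' : Sym2 A → ℝ} (h0 : ∀ z, 0 ≤ w z) (h : ∀ z, w z ≤ w' z) :
    homDensity E w ≤ homDensity E w' := by
  unfold homDensity
  gcongr with x _ e
  · exact fun e _ => h0 _
  · exact h _

theorem edgeDensity_nonneg {A : Type*} [Fintype A] {w : Sym2 A → ℝ} (h0 : ∀ z, 0 ≤ w z) :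
    0 ≤ edgeDensity w :=
  div_nonneg (Finset.sum_nonneg fun _ _ => h0 _) (by positivity)

theorem homDensity_nonneg {V A : Type*} [Fintype V] [DecidableEq V] [Fintype A]
    (E : Finset (Sym2 V)) {w : Sym2 A → ℝ} (h0 : ∀ z, 0 ≤ w z) : 0 ≤ homDensity E w :=
  div_nonneg (Finset.sum_nonneg fun _ _ => Finset.prod_nonneg fun _ _ => h0 _) (by positivity)

theorem IsFinSidorenko.glue {V₁ V₂ V : Type*} [Fintype V₁] [DecidableEq V₁] [Fintype V₂]
    [DecidableEq V₂] [Fintype V] [DecidableEq V]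
    {i₁ : V₁ → V} {i₂ : V₂ → V} {a₁ b₁ : V₁} {a₂ b₂ : V₂} (hab : a₁ ≠ b₁)
    (hinj₁ : Function.Injective i₁) (hinj₂ : Function.Injective i₂)
    (hcover : ∀ v : V, (∃ u, i₁ u = v) ∨ (∃ u, i₂ u = v))
    (ha : i₁ a₁ = i₂ a₂) (hb : i₁ b₁ = i₂ b₂)
    (hmeet : ∀ u₁ u₂, i₁ u₁ = i₂ u₂ → (u₁ = a₁ ∧ u₂ = a₂) ∨ (u₁ = b₁ ∧ u₂ = b₂))
    {E₁ : Finset (Sym2 V₁)} {E₂ : Finset (Sym2 V₂)} {E : Finset (Sym2 V)}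
    (he₁ : s(a₁, b₁) ∈ E₁) (he₂ : s(a₂, b₂) ∈ E₂)
    (hE : E = E₁.image (Sym2.map i₁) ∪ (E₂.erase s(a₂, b₂)).image (Sym2.map i₂))
    (hdisj : Disjoint (E₁.image (Sym2.map i₁)) ((E₂.erase s(a₂, b₂)).image (Sym2.map i₂)))
    (h₁ : IsFinSidorenko E₁) (h₂ : IsFinSidorenko E₂) : IsFinSidorenko E := by
  intro A _ _ w hw
  classical
  have hcard : E.card + 1 = E₁.card + E₂.card := by
    rw [hE, Finset.card_union_of_disjoint hdisj,
      Finset.card_image_of_injective _ (Sym2.map.injective hinj₁),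
      Finset.card_image_of_injective _ (Sym2.map.injective hinj₂), add_assoc,
      Finset.card_erase_add_one he₂]
  have hE0 : E.card ≠ 0 := by
    have := Finset.card_pos.2 ⟨_, he₁⟩
    have := Finset.card_pos.2 ⟨_, he₂⟩
    omega
  have key (n : ℕ) (M : A × A → ℕ) (hM : ∀ c, M c.swap = M c) :
      edgeDensity (typeClass (ι := Fin n ⊕ Fin n) w M) ^ E.card ≤
        homDensity E (typeClass (ι := Fin n ⊕ Fin n) w M) := by
    set w' := typeClass (ι := Fin n ⊕ Fin n) w M
    have hw' : ∀ z, 0 ≤ w' z := typeClass_nonneg hw M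
    have hmul := homDensity_mul_edgeDensity hab hinj₁ hinj₂ hcover ha hb hmeet he₁ he₂ hE hdisj
      w' (typeClass_trans w hM)
    rcases (edgeDensity_nonneg hw').eq_or_lt with h0 | hpos
    · rw [← h0, zero_pow hE0]
      exact homDensity_nonneg E hw'
    · refine le_of_mul_le_mul_right ?_ hpos
      rw [hmul, ← pow_succ, hcard, pow_add]
      exact mul_le_mul (h₁ _ w' hw') (h₂ _ w' hw') (pow_nonneg hpos.le _)
        (homDensity_nonneg E₁ hw')
  have hd := edgeDensity_nonneg hw
  have ht := homDensity_nonneg E hw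
  refine (pow_le_pow_iff_left₀ (pow_nonneg hd _) ht two_ne_zero).1 ?_
  refine le_of_forall_pow_le (pow_nonneg ht _) (2 * Fintype.card (A × A) * E.card) fun n => ?_
  obtain ⟨M, hM, hle⟩ := exists_typeClass hw n
  calc ((edgeDensity w ^ E.card) ^ 2) ^ n = (edgeDensity w ^ (2 * n)) ^ E.card := by ring
    _ ≤ (edgeDensity (typeClass (ι := Fin n ⊕ Fin n) w M) *
        ((n : ℝ) + 1) ^ (2 * Fintype.card (A × A))) ^ E.card := by gcongr
    _ = edgeDensity (typeClass (ι := Fin n ⊕ Fin n) w M) ^ E.card *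
        ((n : ℝ) + 1) ^ (2 * Fintype.card (A × A) * E.card) := by rw [mul_pow, ← pow_mul]
    _ ≤ homDensity E (tensorPow (Fin n ⊕ Fin n) w) *
        ((n : ℝ) + 1) ^ (2 * Fintype.card (A × A) * E.card) := by
      gcongr
      exact (key n M hM).trans (homDensity_mono E (typeClass_nonneg hw M) (typeClass_le hw M))
    _ = _ := by
      rw [homDensity_tensorPow, Fintype.card_sum, Fintype.card_fin, ← two_mul, pow_mul]

section Graphon

variable {V : Type*}

theorem _root_.IsSidorenko.isFinSidorenko {V : Type} [Fintype V] [DecidableEq V]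
    {H : SimpleGraph V} (hs : IsSidorenko H) {E : Finset (Sym2 V)}
    (hE : ∀ e, e ∈ E ↔ e ∈ H.edgeSet) : IsFinSidorenko E := by
  classical
  intro A _ _ w hw
  let : MeasurableSpace A := ⊤
  have : DiscreteMeasurableSpace A := ⟨fun _ => trivial⟩
  let μ : Measure A := (PMF.uniformOfFintype A).toMeasure
  obtain ⟨f, hf, hfμ⟩ := Measure.exists_measurable_map_eq μ
  have hμ (a : A) : μ.real {a} = (Fintype.card A : ℝ)⁻¹ := by
    rw [Measure.real, PMF.toMeasure_apply_singleton _ _ (measurableSet_singleton a)]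
    simp
  have hfp : MeasurePreserving f volume μ := ⟨hf, hfμ⟩
  have hpi : MeasurePreserving (fun (x : V → I) v => f (x v)) volume (Measure.pi fun _ => μ) :=
    measurePreserving_pi _ _ fun _ => hfp
  have hV (F : (V → A) → ℝ) : ∫ x : V → I, F (fun v => f (x v)) =
      (∑ a, F a) / (Fintype.card A : ℝ) ^ Fintype.card V := by
    rw [← integral_map hpi.measurable.aemeasurable
      (measurable_of_finite F).aestronglyMeasurable, hpi.map_eq,
      integral_fintype .of_finite, Finset.sum_div]
    refine Finset.sum_congr rfl fun a _ => ?_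
    simp only [Measure.real, Measure.pi_singleton, ENNReal.toReal_prod, smul_eq_mul]
    change (∏ i, μ.real {a i}) * _ = _
    simp only [hμ, Finset.prod_const, Finset.card_univ]
    rw [inv_pow, div_eq_inv_mul]
  have hA (F : A → ℝ) : ∫ u : I, F (f u) = (∑ a, F a) / (Fintype.card A : ℝ) := by
    rw [← integral_map hf.aemeasurable (measurable_of_finite F).aestronglyMeasurable, hfμ,
      integral_fintype .of_finite, Finset.sum_div]
    simp only [hμ, smul_eq_mul, div_eq_inv_mul]
  have hEH := Finset.ext_iff.2 fun e => (hE e).trans (SimpleGraph.mem_edgeFinset (G := H)).symm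
  have h := hs (fun u v => w s(f u, f v))
    ((measurable_of_finite fun p : A × A => w s(p.1, p.2)).comp
      ((hf.comp measurable_fst).prodMk (hf.comp measurable_snd)))
    (fun _ _ => hw _)
    ⟨∑ z, w z, fun u v => Finset.single_le_sum (fun z _ => hw z) (Finset.mem_univ _)⟩
    (fun u v => by rw [Sym2.eq_swap])
  rw [← hEH] at h
  have hprod (x : V → I) (e : Sym2 V) :
      Sym2.lift ⟨fun a b => w s(f (x a), f (x b)), fun a b => congrArg w Sym2.eq_swap⟩ e =
        w (e.map fun v => f (x v)) := by
    induction e with | _ a b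
    rfl
  have hedge : ∫ u : I, ∫ v : I, w s(f u, f v) = edgeDensity w := by
    have (u : I) := hA fun b => w s(f u, b)
    simp only [this]
    rw [hA fun a => (∑ b, w s(a, b)) / (Fintype.card A : ℝ), ← Finset.sum_div, div_div, ← pow_two,
      ← Fintype.sum_prod_type']
    rfl
  simp only [hprod, hedge] at h
  rw [hV fun a => ∏ e ∈ E, w (e.map a)] at h
  exact h

theorem measurePreserving_comp_injective [Fintype V] {κ : Type*} [Fintype κ] {φ : V → κ}
    (hφ : Function.Injective φ) :
    MeasurePreserving (fun (x : κ → I) v => x (φ v)) volume volume := by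
  refine ⟨by fun_prop, ?_⟩
  have hind := (ProbabilityTheory.iIndepFun_pi (μ := fun _ : κ => (volume : Measure I))
    (X := fun _ => id) fun _ => aemeasurable_id).precomp hφ
  have := (ProbabilityTheory.iIndepFun_iff_map_fun_eq_pi_map
    (fun v => (measurable_pi_apply (φ v)).aemeasurable)).1 hind
  refine this.trans ?_
  congr 1
  funext v
  exact (measurePreserving_eval (fun _ : κ => (volume : Measure I)) (φ v)).map_eq

theorem integral_comp_injective [Fintype V] {κ : Type*} [Fintype κ] {φ : V → κ}
    (hφ : Function.Injective φ) {F : (V → I) → ℝ} (hF : Measurable F) :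
    ∫ x : κ → I, F (fun v => x (φ v)) = ∫ x, F x := by
  have h := measurePreserving_comp_injective hφ
  rw [← integral_map h.measurable.aemeasurable hF.aestronglyMeasurable, h.map_eq]

variable {ω : Sym2 I → ℝ}

theorem measurable_sym2_map (hω : Measurable fun p : I × I => ω s(p.1, p.2)) (e : Sym2 V) :
    Measurable fun x : V → I => ω (e.map x) := by
  induction e with | _ a b
  have h : Measurable fun x : V → I => (x a, x b) :=
    (measurable_pi_apply a).prodMk (measurable_pi_apply b)
  exact hω.comp h

theorem integral_pair [Fintype V] (hω : Measurable fun p : I × I => ω s(p.1, p.2)) {C : ℝ}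
    (h0 : ∀ z, 0 ≤ ω z) (hC : ∀ z, ω z ≤ C) {i j : V} (hij : i ≠ j) :
    ∫ x : V → I, ω s(x i, x j) = ∫ u : I, ∫ v : I, ω s(u, v) := by
  have hφ : Function.Injective ![i, j] := by
    intro a b
    fin_cases a <;> fin_cases b <;> simp [hij, hij.symm]
  have h := integral_comp_injective hφ (F := fun x => ω s(x 0, x 1))
    (measurable_sym2_map hω s(0, 1))
  have hint : Integrable (fun p : I × I => ω s(p.1, p.2)) (volume.prod volume) :=
    .of_bound hω.aestronglyMeasurable C (.of_forall fun p => by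
      rw [Real.norm_of_nonneg (h0 _)]; exact hC _)
  refine h.trans ?_
  rw [← integral_prod _ hint, ← Measure.volume_eq_prod,
    ← (volume_preserving_finTwoArrow I).map_eq,
    integral_map (MeasurableEquiv.measurable _).aemeasurable hω.aestronglyMeasurable]
  rfl

/-- Evaluating the finite Sidorenko inequality at the graph sampled from `k` random points. -/
theorem IsFinSidorenko.sampled [Fintype V] [DecidableEq V] {E : Finset (Sym2 V)}
    (hE : IsFinSidorenko E)
    (hω : Measurable fun p : I × I => ω s(p.1, p.2)) {C : ℝ}
    (h0 : ∀ z, 0 ≤ ω z) (hC : ∀ z, ω z ≤ C) (k : ℕ) [NeZero k] :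
    ((1 - (k : ℝ)⁻¹) * ∫ u : I, ∫ v : I, ω s(u, v)) ^ E.card ≤
      (k.descFactorial (Fintype.card V) / (k : ℝ) ^ Fintype.card V) *
        (∫ x : V → I, ∏ e ∈ E, ω (e.map x)) +
      (1 - k.descFactorial (Fintype.card V) / (k : ℝ) ^ Fintype.card V) * C ^ E.card := by
  have hk : (k : ℝ) ≠ 0 := NeZero.ne _
  set p := ∫ u : I, ∫ v : I, ω s(u, v)
  set t := ∫ x : V → I, ∏ e ∈ E, ω (e.map x)
  have hp : 0 ≤ p := integral_nonneg fun _ => integral_nonneg fun _ => h0 _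
  let G : (Fin k → I) → Sym2 (Fin k) → ℝ := fun x z => ω (z.map x)
  have hGm (z) : Measurable fun x => G x z := measurable_sym2_map hω z
  have hGint (z) : Integrable fun x => G x z :=
    .of_bound (hGm z).aestronglyMeasurable C (.of_forall fun p => by
      rw [Real.norm_of_nonneg (h0 _)]; exact hC _)
  have hprod0 (x : Fin k → I) (φ : V → Fin k) : 0 ≤ ∏ e ∈ E, G x (e.map φ) :=
    Finset.prod_nonneg fun _ _ => h0 _
  have hprodC (x : Fin k → I) (φ : V → Fin k) : ∏ e ∈ E, G x (e.map φ) ≤ C ^ E.card := by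
    rw [← Finset.prod_const]
    exact Finset.prod_le_prod (fun _ _ => h0 _) fun _ _ => hC _
  have hprodint (φ : V → Fin k) : Integrable fun x => ∏ e ∈ E, G x (e.map φ) :=
    .of_bound (Finset.measurable_fun_prod _ fun e _ => hGm _).aestronglyMeasurable (C ^ E.card)
      (.of_forall fun x => by rw [Real.norm_of_nonneg (hprod0 _ _)]; exact hprodC _ _)
  have hhom : Integrable fun x => homDensity E (G x) :=
    (integrable_finsetSum _ fun φ _ => hprodint φ).div_const _
  have hedge0 (x) : 0 ≤ edgeDensity (G x) := edgeDensity_nonneg fun _ => h0 _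
  have hedgem : Measurable fun x => edgeDensity (G x) :=
    (Finset.measurable_fun_sum _ fun p _ => hGm _).div_const _
  have hedgeC (x) : edgeDensity (G x) ≤ C := by
    unfold edgeDensity
    rw [div_le_iff₀ (by simp; positivity)]
    calc _ ≤ ∑ _p : Fin k × Fin k, C := Finset.sum_le_sum fun _ _ => hC _
      _ = _ := by simp; ring
  have hedge : Integrable fun x => edgeDensity (G x) :=
    .of_bound hedgem.aestronglyMeasurable C (.of_forall fun x => by
      rw [Real.norm_of_nonneg (hedge0 x)]; exact hedgeC x)
  have hedgepow : Integrable fun x => edgeDensity (G x) ^ E.card :=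
    .of_bound (hedgem.pow_const _).aestronglyMeasurable (C ^ E.card) (.of_forall fun x => by
      rw [Real.norm_of_nonneg (pow_nonneg (hedge0 x) _)]
      exact pow_le_pow_left₀ (hedge0 x) (hedgeC x) _)
  have hjensen : (∫ x, edgeDensity (G x)) ^ E.card ≤ ∫ x, edgeDensity (G x) ^ E.card :=
    (convexOn_pow E.card).map_integral_le (by fun_prop) isClosed_Ici
      (.of_forall hedge0) hedge hedgepow
  have hlow : (1 - (k : ℝ)⁻¹) * p ≤ ∫ x, edgeDensity (G x) := by
    unfold edgeDensity
    rw [integral_div, integral_finsetSum _ fun p _ => hGint _]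
    have hterm (q : Fin k × Fin k) :
        (p - if q.1 = q.2 then p else 0) ≤ ∫ x, G x s(q.1, q.2) := by
      split_ifs with h
      · rw [sub_self]
        exact integral_nonneg fun _ => h0 _
      · rw [sub_zero]
        exact (integral_pair hω h0 hC h).ge
    rw [le_div_iff₀ (by simp; positivity)]
    refine le_trans (le_of_eq ?_) (Finset.sum_le_sum fun q _ => hterm q)
    rw [Finset.sum_sub_distrib, Fintype.sum_prod_type, Fintype.sum_prod_type]
    simp
    field_simp
  have hhigh : ∫ x, homDensity E (G x) ≤
      (k.descFactorial (Fintype.card V) / (k : ℝ) ^ Fintype.card V) * t +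
      (1 - k.descFactorial (Fintype.card V) / (k : ℝ) ^ Fintype.card V) * C ^ E.card := by
    classical
    unfold homDensity
    rw [integral_div, integral_finsetSum _ fun φ _ => hprodint φ]
    have hterm (φ : V → Fin k) : ∫ x, ∏ e ∈ E, G x (e.map φ) ≤
        C ^ E.card + if Function.Injective φ then t - C ^ E.card else 0 := by
      split_ifs with h
      · rw [add_sub_cancel]
        refine le_of_eq ?_
        simp only [G, Sym2.map_map]
        exact integral_comp_injective h (F := fun x => ∏ e ∈ E, ω (e.map x))
          (Finset.measurable_fun_prod _ fun e _ => measurable_sym2_map hω e)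
      · rw [add_zero]
        refine (integral_mono (hprodint φ) (integrable_const _) fun x => hprodC x φ).trans ?_
        simp
    have hinj : (Finset.univ.filter fun φ : V → Fin k => Function.Injective φ).card =
        k.descFactorial (Fintype.card V) := by
      rw [← Fintype.card_subtype,
        Fintype.card_congr (Equiv.subtypeInjectiveEquivEmbedding V (Fin k)),
        Fintype.card_embedding_eq, Fintype.card_fin]
    rw [Fintype.card_fin, div_le_iff₀ (by positivity)]
    refine (Finset.sum_le_sum fun φ _ => hterm φ).trans (le_of_eq ?_)
    rw [Finset.sum_add_distrib, ← Finset.sum_filter, Finset.sum_const, Finset.sum_const, hinj,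
      Finset.card_univ, Fintype.card_fun, Fintype.card_fin, nsmul_eq_mul, nsmul_eq_mul]
    push_cast
    field_simp
    ring
  have hk1 : 0 ≤ 1 - (k : ℝ)⁻¹ :=
    sub_nonneg.2 (inv_le_one_of_one_le₀ (by exact_mod_cast NeZero.one_le))
  calc _ ≤ (∫ x, edgeDensity (G x)) ^ E.card :=
        pow_le_pow_left₀ (mul_nonneg hk1 hp) hlow _
    _ ≤ ∫ x, edgeDensity (G x) ^ E.card := hjensen
    _ ≤ ∫ x, homDensity E (G x) :=
        integral_mono hedgepow hhom fun x => hE _ _ fun _ => h0 _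
    _ ≤ _ := hhigh

theorem IsFinSidorenko.le_integral [Fintype V] [DecidableEq V] {E : Finset (Sym2 V)}
    (hE : IsFinSidorenko E)
    (hω : Measurable fun p : I × I => ω s(p.1, p.2)) {C : ℝ}
    (h0 : ∀ z, 0 ≤ ω z) (hC : ∀ z, ω z ≤ C) :
    (∫ u : I, ∫ v : I, ω s(u, v)) ^ E.card ≤ ∫ x : V → I, ∏ e ∈ E, ω (e.map x) := by
  set p := ∫ u : I, ∫ v : I, ω s(u, v)
  set t := ∫ x : V → I, ∏ e ∈ E, ω (e.map x)
  have hr : Filter.Tendsto (fun k : ℕ => (k.descFactorial (Fintype.card V) : ℝ) /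
      (k : ℝ) ^ Fintype.card V) Filter.atTop (nhds 1) := by
    refine (Asymptotics.isEquivalent_iff_tendsto_one ?_).1
      (isEquivalent_descFactorial (Fintype.card V))
    filter_upwards [Filter.eventually_ne_atTop 0] with k hk
    simp [hk]
  have hleft : Filter.Tendsto (fun k : ℕ => ((1 - (k : ℝ)⁻¹) * p) ^ E.card) Filter.atTop
      (nhds (p ^ E.card)) := by
    simpa using (((tendsto_inv_atTop_nhds_zero_nat (𝕜 := ℝ)).const_sub 1).mul_const p).pow E.card
  have hright := (hr.mul_const t).add ((hr.const_sub 1).mul_const (C ^ E.card))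
  rw [one_mul, sub_self, zero_mul, add_zero] at hright
  refine le_of_tendsto_of_tendsto hleft hright ?_
  filter_upwards [Filter.eventually_ne_atTop 0] with k hk
  have : NeZero k := ⟨hk⟩
  exact hE.sampled hω h0 hC k

theorem IsFinSidorenko.isSidorenko {V : Type} [Fintype V] [DecidableEq V]
    {H : SimpleGraph V} {E : Finset (Sym2 V)} (hE : ∀ e, e ∈ E ↔ e ∈ H.edgeSet)
    (hs : IsFinSidorenko E) : IsSidorenko H := by
  classical
  rintro W hW h0 ⟨C, hC⟩ hsym
  have hEH := Finset.ext_iff.2 fun e => (hE e).trans (SimpleGraph.mem_edgeFinset (G := H)).symm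
  rw [← hEH]
  let ω : Sym2 I → ℝ := Sym2.lift ⟨W, hsym⟩
  have hprod (x : V → I) (e : Sym2 V) :
      Sym2.lift ⟨fun a b => W (x a) (x b), fun a b => hsym (x a) (x b)⟩ e = ω (e.map x) := by
    induction e with | _ a b
    rfl
  simp only [hprod]
  exact hs.le_integral (ω := ω) hW (Sym2.ind h0) (Sym2.ind hC)

end Graphon

end Sidorenko

/-- Edge gluing: if `H₁, H₂` are Sidorenko bipartite graphs with edges `e₁ = (a₁,b₁)`,
`e₂ = (a₂,b₂)`, then the graph `H` obtained from `H₁` and `H₂` by identifying `e₁` with `e₂`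
(described here via embeddings `i₁, i₂` covering `H`, meeting exactly in the glued edge,
with the edges of `H` being exactly those coming from `H₁` or `H₂`) is also Sidorenko. -/
theorem edge_gluing {V₁ V₂ V : Type} [Fintype V₁] [DecidableEq V₁] [Fintype V₂]
    [DecidableEq V₂] [Fintype V] [DecidableEq V]
    (H₁ : SimpleGraph V₁) (H₂ : SimpleGraph V₂) (H : SimpleGraph V)
    (hbip₁ : H₁.Colorable 2) (hbip₂ : H₂.Colorable 2)
    (a₁ b₁ : V₁) (a₂ b₂ : V₂) (he₁ : H₁.Adj a₁ b₁) (he₂ : H₂.Adj a₂ b₂)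
    (i₁ : V₁ → V) (i₂ : V₂ → V)
    (hinj₁ : Function.Injective i₁) (hinj₂ : Function.Injective i₂)
    (hcover : ∀ v : V, (∃ u, i₁ u = v) ∨ (∃ u, i₂ u = v))
    (ha : i₁ a₁ = i₂ a₂) (hb : i₁ b₁ = i₂ b₂)
    (hmeet : ∀ u₁ u₂, i₁ u₁ = i₂ u₂ → (u₁ = a₁ ∧ u₂ = a₂) ∨ (u₁ = b₁ ∧ u₂ = b₂))
    (hadj : ∀ v w : V, H.Adj v w ↔
      ((∃ u₁ u₂, i₁ u₁ = v ∧ i₁ u₂ = w ∧ H₁.Adj u₁ u₂) ∨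
        (∃ u₁ u₂, i₂ u₁ = v ∧ i₂ u₂ = w ∧ H₂.Adj u₁ u₂)))
    (hs₁ : IsSidorenko H₁) (hs₂ : IsSidorenko H₂) :
    IsSidorenko H := by
  classical
  have hmem (e : Sym2 V₂) (h : e ∈ H₂.edgeFinset.erase s(a₂, b₂)) : e.map i₂ ∉
      H₁.edgeFinset.image (Sym2.map i₁) := by
    simp only [Finset.mem_erase, SimpleGraph.mem_edgeFinset] at h
    simp only [Finset.mem_image, SimpleGraph.mem_edgeFinset, not_exists, not_and]
    intro d hd hde
    induction d with | _ x y
    induction e with | _ u v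
    have hne := H₁.ne_of_adj hd
    have aux {x y u v} (hxy : x ≠ y) (hx : i₁ x = i₂ u) (hy : i₁ y = i₂ v) :
        s(u, v) = s(a₂, b₂) := by
      rcases hmeet _ _ hx with ⟨rfl, rfl⟩ | ⟨rfl, rfl⟩ <;>
        rcases hmeet _ _ hy with ⟨rfl, rfl⟩ | ⟨rfl, rfl⟩
      · exact absurd rfl hxy
      · rfl
      · exact Sym2.eq_swap
      · exact absurd rfl hxy
    rcases Sym2.eq_iff.1 hde with ⟨hx, hy⟩ | ⟨hx, hy⟩
    · exact h.1 (aux hne hx hy)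
    · exact h.1 (Sym2.eq_swap.trans (aux hne hx hy))
  have hE : H.edgeFinset = H₁.edgeFinset.image (Sym2.map i₁) ∪
      (H₂.edgeFinset.erase s(a₂, b₂)).image (Sym2.map i₂) := by
    ext e
    induction e with | _ v w
    simp only [SimpleGraph.mem_edgeFinset, SimpleGraph.mem_edgeSet, Finset.mem_union,
      Finset.mem_image, Finset.mem_erase]
    rw [hadj]
    constructor
    · rintro (⟨u₁, u₂, rfl, rfl, h⟩ | ⟨u₁, u₂, rfl, rfl, h⟩)
      · exact Or.inl ⟨s(u₁, u₂), h, rfl⟩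
      · by_cases he : s(u₁, u₂) = s(a₂, b₂)
        · refine Or.inl ⟨s(a₁, b₁), he₁, ?_⟩
          rw [← Sym2.map_mk, he, Sym2.map_mk, Sym2.map_mk, ha, hb]
        · exact Or.inr ⟨s(u₁, u₂), ⟨he, h⟩, rfl⟩
    · rintro (⟨d, h, hd⟩ | ⟨d, ⟨-, h⟩, hd⟩) <;> induction d with | _ x y
      · rcases Sym2.eq_iff.1 hd with ⟨hx, hy⟩ | ⟨hx, hy⟩
        · exact Or.inl ⟨x, y, hx, hy, h⟩
        · exact Or.inl ⟨y, x, hy, hx, h.symm⟩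
      · rcases Sym2.eq_iff.1 hd with ⟨hx, hy⟩ | ⟨hx, hy⟩
        · exact Or.inr ⟨x, y, hx, hy, h⟩
        · exact Or.inr ⟨y, x, hy, hx, h.symm⟩
  have hdisj : Disjoint (H₁.edgeFinset.image (Sym2.map i₁))
      ((H₂.edgeFinset.erase s(a₂, b₂)).image (Sym2.map i₂)) := by
    refine Finset.disjoint_right.2 fun e he => ?_
    obtain ⟨d, hd, rfl⟩ := Finset.mem_image.1 he
    exact hmem d hd
  exact (Sidorenko.IsFinSidorenko.glue he₁.ne hinj₁ hinj₂ hcover ha hb hmeet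
    (SimpleGraph.mem_edgeFinset.2 he₁) (SimpleGraph.mem_edgeFinset.2 he₂) hE hdisj
    (hs₁.isFinSidorenko fun _ => SimpleGraph.mem_edgeFinset)
    (hs₂.isFinSidorenko fun _ => SimpleGraph.mem_edgeFinset)).isSidorenko
    fun _ => SimpleGraph.mem_edgeFinset
end

section
/- Let H be a bipartite graph on {x₁,…,x_m} whose induced subgraph on S = {x₁,…,x_n} is a tree T, and suppose T is smooth in H, i.e., E(f_T · ln t_S(H*, W)) ≥ |E(H*)| ln d for all strictly positive bounded symmetric W, where H* is H with the edges of T removed. If x_n is a leaf of T and T' is the subtree T − x_n on S' = S ∖ {x_n}, then T' is smooth in the graph H with x_n unlabeled, i.e., E(f_{T'} · ln t_{S'}(H₂*, W)) ≥ |E(H₂*)| ln d where H₂* is H with the edges of T' removed. -/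
open MeasureTheory Real unitInterval

noncomputable section
open scoped Classical

/-- The product of `W` over the edges of a graph, evaluated at a vertex-assignment `x`;
`W` is assumed symmetric via `hsym`. -/
def edgeProd {k : ℕ} (G : SimpleGraph (Fin k)) (W : I → I → ℝ)
    (hsym : ∀ x y, W x y = W y x) (x : Fin k → I) : ℝ :=
  ∏ e ∈ G.edgeFinset,
    Sym2.lift ⟨fun a b => W (x a) (x b), fun a b => hsym (x a) (x b)⟩ e

/-- `d = ∫∫ W`, the edge density of the kernel `W`. -/
def kernelDensity (W : I → I → ℝ) : ℝ := ∫ x : I, ∫ y : I, W x y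

/-- The degree function `d(x) = ∫ W(x,y) dy`. -/
def kernelDeg (W : I → I → ℝ) (x : I) : ℝ := ∫ y : I, W x y

/-- The canonical tree weight `f_T = d⁻¹ ∏ᵢ d(xᵢ)^{1-rᵢ} ∏_{(xᵢ,xⱼ)∈E(T)} W(xᵢ,xⱼ)`. -/
def treeWeight {n : ℕ} (T : SimpleGraph (Fin n)) (W : I → I → ℝ)
    (hsym : ∀ x y, W x y = W y x) (x : Fin n → I) : ℝ :=
  (kernelDensity W)⁻¹ * (∏ i : Fin n, kernelDeg W (x i) ^ ((1 : ℤ) - (T.degree i : ℤ))) *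
    edgeProd T W hsym x

/-- Extend an assignment `y` of the first `n` (labeled) vertices by `x` on the rest. -/
def extAssign {m n : ℕ} (hnm : n ≤ m) (y : Fin n → I) (x : Fin m → I) : Fin m → I :=
  fun i => if h : (i : ℕ) < n then y ⟨i, h⟩ else x i

/-- The restricted density `t_S(G, W)` of a graph `G` on `Fin m`, with the first `n`
vertices (the labeled set `S`) fixed to `y`. -/
def restrictedDensity {m n : ℕ} (hnm : n ≤ m) (G : SimpleGraph (Fin m)) (W : I → I → ℝ)
    (hsym : ∀ x y, W x y = W y x) (y : Fin n → I) : ℝ :=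
  ∫ x : Fin m → I, edgeProd G W hsym (extAssign hnm y x)

/-- `H*`: the graph `H` with the edges of the tree `T` (spanned on the first `n` vertices)
deleted. -/
def deleteTreeEdges {m n : ℕ} (hnm : n ≤ m) (H : SimpleGraph (Fin m))
    (T : SimpleGraph (Fin n)) : SimpleGraph (Fin m) :=
  H.deleteEdges (Sym2.map (Fin.castLE hnm) '' T.edgeSet)

/-- The tree `T`, spanned on the first `n` (labeled) vertices of `H`, is *smooth* in `H`:
for every strictly positive bounded symmetric measurable `W`,
`E(f_T · ln t_S(H*, W)) ≥ |E(H*)| ln d`. -/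
def IsSmooth {m n : ℕ} (hnm : n ≤ m) (H : SimpleGraph (Fin m))
    (T : SimpleGraph (Fin n)) : Prop :=
  ∀ (W : I → I → ℝ), Measurable (Function.uncurry W) →
    (∃ c : ℝ, 0 < c ∧ ∀ x y, c ≤ W x y) → (∃ C : ℝ, ∀ x y, W x y ≤ C) →
    ∀ (hsym : ∀ x y, W x y = W y x),
    (∫ y : Fin n → I, treeWeight T W hsym y *
        Real.log (restrictedDensity hnm (deleteTreeEdges hnm H T) W hsym y))
      ≥ ((deleteTreeEdges hnm H T).edgeFinset.card : ℝ) * Real.log (kernelDensity W)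


/-- A measurable function with bounded absolute value. -/
def BddMeas {α : Type*} [MeasurableSpace α] (f : α → ℝ) : Prop :=
  Measurable f ∧ ∃ C : ℝ, ∀ x, |f x| ≤ C

/-- A measurable function bounded between two positive constants. -/
def PosBdd {α : Type*} [MeasurableSpace α] (f : α → ℝ) : Prop :=
  Measurable f ∧ (∃ c : ℝ, 0 < c ∧ ∀ x, c ≤ f x) ∧ ∃ C : ℝ, ∀ x, f x ≤ C

section Bounded

variable {α β : Type*} [MeasurableSpace α] [MeasurableSpace β]

theorem PosBdd.pos {f : α → ℝ} (hf : PosBdd f) (x : α) : 0 < f x :=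
  let ⟨_, hc, h⟩ := hf.2.1
  hc.trans_le (h x)

theorem PosBdd.bddMeas {f : α → ℝ} (hf : PosBdd f) : BddMeas f :=
  let ⟨C, hC⟩ := hf.2.2
  ⟨hf.1, C, fun x => (abs_of_pos (hf.pos x)).trans_le (hC x)⟩

theorem BddMeas.comp {f : α → ℝ} (hf : BddMeas f) {g : β → α} (hg : Measurable g) :
    BddMeas fun x => f (g x) :=
  let ⟨C, hC⟩ := hf.2
  ⟨hf.1.comp hg, C, fun x => hC (g x)⟩

theorem PosBdd.comp {f : α → ℝ} (hf : PosBdd f) {g : β → α} (hg : Measurable g) :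
    PosBdd fun x => f (g x) :=
  let ⟨c, hc, h⟩ := hf.2.1
  let ⟨C, hC⟩ := hf.2.2
  ⟨hf.1.comp hg, ⟨c, hc, fun x => h (g x)⟩, C, fun x => hC (g x)⟩

theorem BddMeas.mul {f g : α → ℝ} (hf : BddMeas f) (hg : BddMeas g) :
    BddMeas fun x => f x * g x := by
  obtain ⟨C, hC⟩ := hf.2
  obtain ⟨D, hD⟩ := hg.2
  refine ⟨hf.1.mul hg.1, C * D, fun x => ?_⟩
  rw [abs_mul]
  exact mul_le_mul (hC x) (hD x) (abs_nonneg _) ((abs_nonneg _).trans (hC x))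

theorem PosBdd.mul {f g : α → ℝ} (hf : PosBdd f) (hg : PosBdd g) :
    PosBdd fun x => f x * g x := by
  obtain ⟨c, hc, hfc⟩ := hf.2.1
  obtain ⟨C, hC⟩ := hf.2.2
  obtain ⟨d, hd, hgd⟩ := hg.2.1
  obtain ⟨D, hD⟩ := hg.2.2
  exact ⟨hf.1.mul hg.1,
    ⟨c * d, mul_pos hc hd, fun x => mul_le_mul (hfc x) (hgd x) hd.le (hf.pos x).le⟩,
    C * D, fun x => mul_le_mul (hC x) (hD x) (hg.pos x).le ((hf.pos x).le.trans (hC x))⟩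

theorem PosBdd.inv {f : α → ℝ} (hf : PosBdd f) : PosBdd fun x => (f x)⁻¹ := by
  obtain ⟨c, hc, hfc⟩ := hf.2.1
  obtain ⟨C, hC⟩ := hf.2.2
  refine ⟨hf.1.inv, ⟨(max C 1)⁻¹, by positivity, fun x => ?_⟩, c⁻¹, fun x => ?_⟩
  · exact inv_anti₀ (hf.pos x) ((hC x).trans (le_max_left _ _))
  · exact inv_anti₀ hc (hfc x)

theorem posBdd_const {c : ℝ} (hc : 0 < c) : PosBdd fun _ : α => c :=
  ⟨measurable_const, ⟨c, hc, fun _ => le_rfl⟩, c, fun _ => le_rfl⟩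

theorem PosBdd.pow {f : α → ℝ} (hf : PosBdd f) (n : ℕ) : PosBdd fun x => f x ^ n := by
  induction n with
  | zero => simpa using posBdd_const (α := α) one_pos
  | succ n ih => simpa only [pow_succ] using ih.mul hf

theorem PosBdd.zpow {f : α → ℝ} (hf : PosBdd f) (n : ℤ) : PosBdd fun x => f x ^ n := by
  cases n with
  | ofNat n => simpa using hf.pow n
  | negSucc n => simpa only [zpow_negSucc] using (hf.pow (n + 1)).inv

theorem PosBdd.prod {ι : Type*} {f : ι → α → ℝ} (s : Finset ι)
    (hf : ∀ i ∈ s, PosBdd (f i)) : PosBdd fun x => ∏ i ∈ s, f i x := by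
  induction s using Finset.induction_on with
  | empty => simpa using posBdd_const (α := α) one_pos
  | insert i s hi ih =>
    simp only [Finset.prod_insert hi]
    exact (hf i (Finset.mem_insert_self _ _)).mul
      (ih fun j hj => hf j (Finset.mem_insert_of_mem hj))

theorem PosBdd.log {f : α → ℝ} (hf : PosBdd f) : BddMeas fun x => Real.log (f x) := by
  obtain ⟨c, hc, hfc⟩ := hf.2.1
  obtain ⟨C, hC⟩ := hf.2.2
  refine ⟨hf.1.log, max |Real.log c| |Real.log C|, fun x => ?_⟩
  exact abs_le_max_abs_abs (Real.log_le_log hc (hfc x)) (Real.log_le_log (hf.pos x) (hC x))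

theorem BddMeas.integrable {f : α → ℝ} (hf : BddMeas f) (μ : Measure α) [IsFiniteMeasure μ] :
    Integrable f μ :=
  let ⟨C, hC⟩ := hf.2
  .of_bound hf.1.aestronglyMeasurable C (.of_forall hC)

theorem PosBdd.integrable {f : α → ℝ} (hf : PosBdd f) (μ : Measure α) [IsFiniteMeasure μ] :
    Integrable f μ :=
  hf.bddMeas.integrable μ

theorem BddMeas.integral {f : α × β → ℝ} (hf : BddMeas f) (μ : Measure β)
    [IsProbabilityMeasure μ] : BddMeas fun x => ∫ y, f (x, y) ∂μ := by
  obtain ⟨C, hC⟩ := hf.2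
  refine ⟨hf.1.stronglyMeasurable.integral_prod_right'.measurable, C, fun x => ?_⟩
  simpa using norm_integral_le_of_norm_le_const (μ := μ) (f := fun y => f (x, y))
    (.of_forall fun y => hC (x, y))

theorem PosBdd.integral {f : α × β → ℝ} (hf : PosBdd f) (μ : Measure β)
    [IsProbabilityMeasure μ] : PosBdd fun x => ∫ y, f (x, y) ∂μ := by
  obtain ⟨c, hc, hfc⟩ := hf.2.1
  obtain ⟨C, hC⟩ := hf.2.2
  have hint (x : α) : Integrable (fun y => f (x, y)) μ :=
    (hf.comp measurable_prodMk_left).integrable μ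
  refine ⟨(hf.bddMeas.integral μ).1, ⟨c, hc, fun x => ?_⟩, C, fun x => ?_⟩
  · simpa using integral_mono (integrable_const c) (hint x) fun y => hfc (x, y)
  · simpa using integral_mono (hint x) (integrable_const C) fun y => hC (x, y)

/-- Jensen's inequality for the logarithm with respect to a probability density `ρ`. -/
theorem integral_density_mul_log_le (μ : Measure α) [IsProbabilityMeasure μ] {ρ t : α → ℝ}
    (hρ : PosBdd ρ) (hρ1 : ∫ x, ρ x ∂μ = 1) (ht : PosBdd t) :
    ∫ x, ρ x * Real.log (t x) ∂μ ≤ Real.log (∫ x, ρ x * t x ∂μ) := by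
  set A := ∫ x, ρ x * t x ∂μ with hA
  have hApos : 0 < A :=
    ((hρ.mul ht).comp (measurable_snd (α := Unit))).integral μ |>.pos ()
  have hpt (x : α) : ρ x * Real.log (t x) ≤ (Real.log A - 1) * ρ x + A⁻¹ * (ρ x * t x) := by
    have h := Real.log_le_sub_one_of_pos (div_pos (ht.pos x) hApos)
    rw [Real.log_div (ht.pos x).ne' hApos.ne'] at h
    have := mul_le_mul_of_nonneg_left h (hρ.pos x).le
    rw [div_eq_mul_inv] at this
    linarith
  have hi1 := (hρ.integrable μ).const_mul (Real.log A - 1)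
  have hi2 := ((hρ.mul ht).integrable μ).const_mul A⁻¹
  refine (integral_mono ((hρ.bddMeas.mul ht.log).integrable μ) (hi1.add hi2) hpt).trans_eq ?_
  simp only [Pi.add_apply]
  rw [integral_add hi1 hi2, integral_const_mul, integral_const_mul, hρ1, ← hA,
    inv_mul_cancel₀ hApos.ne']
  ring

end Bounded

section Insert

theorem integral_insertNth {k : ℕ} (i : Fin (k + 1)) (F : (Fin (k + 1) → I) → ℝ) :
    ∫ x, F x = ∫ p : I × (Fin k → I), F (i.insertNth p.1 p.2) :=
  ((volume_preserving_piFinSuccAbove (fun _ : Fin (k + 1) => I) i).symm.integral_comp' F).symm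

theorem measurable_insertNth {k : ℕ} (i : Fin (k + 1)) :
    Measurable fun p : I × (Fin k → I) => (i.insertNth p.1 p.2 : Fin (k + 1) → I) :=
  (MeasurableEquiv.piFinSuccAbove (fun _ : Fin (k + 1) => I) i).symm.measurable

theorem integral_eq_integral_insertNth {k : ℕ} (i : Fin (k + 1)) {F : (Fin (k + 1) → I) → ℝ}
    (hF : BddMeas F) : ∫ x, F x = ∫ z : I, ∫ y : Fin k → I, F (i.insertNth z y) := by
  rw [integral_insertNth i, Measure.volume_eq_prod,
    integral_prod _ ((hF.comp (measurable_insertNth i)).integrable _)]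

theorem integral_eq_integral_insertNth_symm {k : ℕ} (i : Fin (k + 1))
    {F : (Fin (k + 1) → I) → ℝ} (hF : BddMeas F) :
    ∫ x, F x = ∫ y : Fin k → I, ∫ z : I, F (i.insertNth z y) := by
  rw [integral_insertNth i, Measure.volume_eq_prod,
    integral_prod_symm _ ((hF.comp (measurable_insertNth i)).integrable _)]

end Insert

section Kernel

variable {W : I → I → ℝ}

theorem posBdd_edgeProd {k : ℕ} (hW : PosBdd (Function.uncurry W))
    (hsym : ∀ x y, W x y = W y x) (G : SimpleGraph (Fin k)) : PosBdd (edgeProd G W hsym) := by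
  have hpair (a b : Fin k) : PosBdd fun x : Fin k → I => W (x a) (x b) :=
    hW.comp (g := fun x : Fin k → I => (x a, x b))
      ((measurable_pi_apply a).prodMk (measurable_pi_apply b))
  refine PosBdd.prod _ fun e _ => ?_
  induction e using Sym2.ind with
  | _ a b => exact hpair a b

theorem posBdd_kernelDeg (hW : PosBdd (Function.uncurry W)) : PosBdd (kernelDeg W) :=
  hW.integral volume

theorem kernelDensity_pos (hW : PosBdd (Function.uncurry W)) : 0 < kernelDensity W :=
  ((posBdd_kernelDeg hW).comp (measurable_snd (α := Unit))).integral volume |>.pos ()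

theorem posBdd_treeWeight {k : ℕ} (hW : PosBdd (Function.uncurry W))
    (hsym : ∀ x y, W x y = W y x) (T : SimpleGraph (Fin k)) : PosBdd (treeWeight T W hsym) :=
  ((posBdd_const (inv_pos.2 (kernelDensity_pos hW))).mul
    (PosBdd.prod _ fun i _ => ((posBdd_kernelDeg hW).zpow _).comp (measurable_pi_apply i))).mul
    (posBdd_edgeProd hW hsym T)

theorem measurable_extAssign {m n : ℕ} (hnm : n ≤ m) :
    Measurable fun p : (Fin n → I) × (Fin m → I) => extAssign hnm p.1 p.2 := by
  refine measurable_pi_iff.2 fun i => ?_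
  unfold extAssign
  by_cases h : (i : ℕ) < n <;> simp only [h, dite_true, dite_false] <;> fun_prop

theorem posBdd_restrictedDensity {m n : ℕ} (hnm : n ≤ m) (hW : PosBdd (Function.uncurry W))
    (hsym : ∀ x y, W x y = W y x) (G : SimpleGraph (Fin m)) :
    PosBdd (restrictedDensity hnm G W hsym) :=
  ((posBdd_edgeProd hW hsym G).comp (measurable_extAssign hnm)).integral volume

theorem edgeProd_of_edgeSet_eq_insert {k l : ℕ} {G : SimpleGraph (Fin l)}
    {G' : SimpleGraph (Fin k)} (hsym : ∀ x y, W x y = W y x) (f : Fin k ↪ Fin l) {a b : Fin l}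
    (h : G.edgeSet = insert s(a, b) (Sym2.map f '' G'.edgeSet))
    (hab : s(a, b) ∉ Sym2.map f '' G'.edgeSet) (x : Fin l → I) :
    edgeProd G W hsym x = W (x a) (x b) * edgeProd G' W hsym (x ∘ f) := by
  have hfin : G.edgeFinset = insert s(a, b)
      (G'.edgeFinset.map ⟨Sym2.map f, Sym2.map.injective f.injective⟩) := by
    ext e
    simp [h]
  unfold edgeProd
  rw [hfin, Finset.prod_insert (by simpa using hab), Finset.prod_map]
  congr 1
  refine Finset.prod_congr rfl fun e _ => ?_
  induction e using Sym2.ind with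
  | _ a b => rfl

end Kernel

section Leaf

variable {k : ℕ} {T : SimpleGraph (Fin (k + 1))} {l : Fin (k + 1)} {p : Fin k}

theorem edgeSet_eq_insert_of_leaf (hl : ∀ j, T.Adj l j ↔ j = l.succAbove p) :
    T.edgeSet = insert s(l.succAbove p, l)
      (Sym2.map l.succAboveEmb '' (T.comap l.succAbove).edgeSet) := by
  ext e
  induction e using Sym2.ind with
  | _ a b =>
    constructor
    · intro h
      rw [SimpleGraph.mem_edgeSet] at h
      rcases Fin.eq_self_or_eq_succAbove l a with rfl | ⟨a, rfl⟩
      · rw [(hl b).1 h, Sym2.eq_swap]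
        exact .inl rfl
      rcases Fin.eq_self_or_eq_succAbove l b with rfl | ⟨b, rfl⟩
      · rw [(hl _).1 h.symm]
        exact .inl rfl
      · exact .inr ⟨s(a, b), h, rfl⟩
    · rintro (h | ⟨e, he, h⟩)
      · rw [h]
        exact ((hl _).2 rfl).symm
      · rw [← h]
        induction e using Sym2.ind with
        | _ a b => exact he

theorem leaf_edge_notMem (l : Fin (k + 1)) (p : Fin k) (G : SimpleGraph (Fin k)) :
    s(l.succAbove p, l) ∉ Sym2.map l.succAboveEmb '' G.edgeSet := by
  rintro ⟨e, -, h⟩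
  have hmem : l ∈ Sym2.map l.succAboveEmb e := h ▸ Sym2.mem_mk_right _ _
  obtain ⟨a, -, ha⟩ := Sym2.mem_map.1 hmem
  exact Fin.succAbove_ne l a ha

theorem exists_adj_iff_of_degree_eq_one (h : T.degree l = 1) :
    ∃ p : Fin k, ∀ j, T.Adj l j ↔ j = l.succAbove p := by
  obtain ⟨u, hu, huniq⟩ := SimpleGraph.degree_eq_one_iff_existsUnique_adj.1 h
  obtain ⟨p, rfl⟩ := Fin.exists_succAbove_eq hu.ne'
  exact ⟨p, fun j => ⟨huniq j, fun h => h ▸ hu⟩⟩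

theorem isTree_comap_succAbove (hT : T.IsTree) (h : T.degree l = 1) :
    (T.comap l.succAbove).IsTree := by
  let e : T.comap l.succAbove ≃g T.induce ({l}ᶜ : Set (Fin (k + 1))) :=
    ⟨finSuccAboveEquiv l, Iff.rfl⟩
  exact ⟨e.connected_iff.2 (hT.connected.induce_compl_singleton_of_degree_eq_one h),
    e.isAcyclic_iff.2 (hT.isAcyclic.induce _)⟩

theorem degree_succAbove {T' : SimpleGraph (Fin k)} (hT' : T.comap l.succAbove = T')
    (hl : ∀ j, T.Adj l j ↔ j = l.succAbove p) (i : Fin k) :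
    T.degree (l.succAbove i) = T'.degree i + if i = p then 1 else 0 := by
  rw [← Nat.cast_id (T.degree _), ← Nat.cast_id (T'.degree i),
    T.degree_eq_sum_if_adj, T'.degree_eq_sum_if_adj, Fin.sum_univ_succAbove _ l, add_comm]
  simp [T.adj_comm _ l, hl, ← hT']

theorem treeWeight_insertNth {W : I → I → ℝ} (hW : PosBdd (Function.uncurry W))
    (hsym : ∀ x y, W x y = W y x) (hl : ∀ j, T.Adj l j ↔ j = l.succAbove p)
    (hdeg : T.degree l = 1) (z : I) (y : Fin k → I) :
    treeWeight T W hsym (l.insertNth z y) =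
      treeWeight (T.comap l.succAbove) W hsym y * ((kernelDeg W (y p))⁻¹ * W (y p) z) := by
  have hedge := edgeSet_eq_insert_of_leaf hl
  generalize hT' : T.comap l.succAbove = T' at hedge ⊢
  have hcomp : (l.insertNth z y : Fin (k + 1) → I) ∘ l.succAboveEmb = y := by
    ext i
    simp
  have hpow (i : Fin k) :
      kernelDeg W (y i) ^ ((1 : ℤ) - (T.degree (l.succAbove i) : ℤ)) =
        kernelDeg W (y i) ^ ((1 : ℤ) - (T'.degree i : ℤ)) *
          if i = p then (kernelDeg W (y p))⁻¹ else 1 := by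
    rw [degree_succAbove hT' hl]
    split_ifs with hi
    · subst hi
      rw [← zpow_sub_one₀ ((posBdd_kernelDeg hW).pos _).ne']
      push_cast
      ring_nf
    · simp
  unfold treeWeight
  rw [edgeProd_of_edgeSet_eq_insert hsym l.succAboveEmb hedge
    (leaf_edge_notMem l p _), hcomp, Fin.prod_univ_succAbove _ l, hdeg]
  simp only [Fin.insertNth_apply_same, Fin.insertNth_apply_succAbove, hpow,
    Finset.prod_mul_distrib, Finset.prod_ite_eq', Finset.mem_univ, if_true]
  simp only [Nat.cast_one, sub_self, zpow_zero]
  ring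

end Leaf

theorem PosBdd.leafDensity {W : I → I → ℝ} (hW : PosBdd (Function.uncurry W)) :
    PosBdd fun q : I × I => (kernelDeg W q.1)⁻¹ * W q.1 q.2 :=
  ((posBdd_kernelDeg hW).inv.comp measurable_fst).mul hW

/-- The marginal of the tree weight at any vertex is `d(x) / d`. -/
theorem integral_treeWeight_mul {W : I → I → ℝ} (hW : PosBdd (Function.uncurry W))
    (hsym : ∀ x y, W x y = W y x) {k : ℕ} (T : SimpleGraph (Fin (k + 1))) (hT : T.IsTree)
    (p : Fin (k + 1)) {g : I → ℝ} (hg : BddMeas g) :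
    ∫ y, treeWeight T W hsym y * g (y p) =
      (kernelDensity W)⁻¹ * ∫ x, kernelDeg W x * g x := by
  have hbdd {k : ℕ} (T : SimpleGraph (Fin k)) (p : Fin k) {g : I → ℝ} (hg : BddMeas g) :
      BddMeas fun y => treeWeight T W hsym y * g (y p) :=
    (posBdd_treeWeight hW hsym T).bddMeas.mul (hg.comp (measurable_pi_apply p))
  induction k generalizing g with
  | zero =>
    have hbot : T = ⊥ := by
      ext a b
      simp [Subsingleton.elim (α := Fin 1) a b]
    have hedge : T.edgeFinset = ∅ := by
      ext e
      simp [hbot]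
    obtain rfl : p = 0 := Subsingleton.elim (α := Fin 1) p 0
    rw [integral_eq_integral_insertNth 0 (hbdd T 0 hg), ← integral_const_mul]
    refine integral_congr_ae (.of_forall fun z => ?_)
    simp [treeWeight, edgeProd, hedge, hbot, mul_assoc]
  | succ k ih =>
    obtain ⟨l, hdeg⟩ := hT.exists_vert_degree_one_of_nontrivial
    replace hdeg : T.degree l = 1 := by convert hdeg
    obtain ⟨q, hl⟩ := exists_adj_iff_of_degree_eq_one hdeg
    have hT' := isTree_comap_succAbove hT hdeg
    have hleaf : BddMeas fun x => ∫ z, (kernelDeg W x)⁻¹ * W x z * g z :=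
      (hW.leafDensity.bddMeas.mul (hg.comp measurable_snd)).integral volume
    have hd (x : I) : kernelDeg W x * (kernelDeg W x)⁻¹ = 1 :=
      mul_inv_cancel₀ ((posBdd_kernelDeg hW).pos x).ne'
    rw [integral_eq_integral_insertNth_symm l (hbdd T p hg)]
    simp only [treeWeight_insertNth hW hsym hl hdeg]
    rcases Fin.eq_self_or_eq_succAbove l p with rfl | ⟨r, rfl⟩
    · simp only [Fin.insertNth_apply_same, mul_assoc (treeWeight _ _ _ _), integral_const_mul]
      rw [ih _ hT' q hleaf]
      congr 1
      have hsw : BddMeas fun a : I × I => W a.1 a.2 * g a.2 :=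
        hW.bddMeas.mul (hg.comp measurable_snd)
      calc ∫ x, kernelDeg W x * ∫ z, (kernelDeg W x)⁻¹ * W x z * g z
          = ∫ x, ∫ z, W x z * g z := by
            simp only [← integral_const_mul, ← mul_assoc, hd, one_mul]
        _ = ∫ z, ∫ x, W x z * g z := integral_integral_swap (hsw.integrable _)
        _ = ∫ z, kernelDeg W z * g z := by
            simp only [integral_mul_const, hsym _ , kernelDeg]
    · have hone (x : I) : ∫ z, (kernelDeg W x)⁻¹ * W x z = 1 := by
        rw [integral_const_mul, mul_comm]
        exact hd x
      simp only [Fin.insertNth_apply_succAbove, integral_mul_const,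
        integral_const_mul (treeWeight _ _ _ _), hone, mul_one]
      exact ih _ hT' r hg


section Main

variable {m k : ℕ}

theorem deleteTreeEdges_edgeSet (hnm : k + 1 ≤ m) {H : SimpleGraph (Fin m)}
    {T : SimpleGraph (Fin (k + 1))} {p : Fin k}
    (hT : ∀ i j, T.Adj i j → H.Adj (Fin.castLE hnm i) (Fin.castLE hnm j))
    (hl : ∀ j, T.Adj (Fin.last k) j ↔ j = (Fin.last k).succAbove p) :
    (deleteTreeEdges (Nat.le_of_succ_le hnm) H (T.comap (Fin.last k).succAbove)).edgeSet =
      insert s(Fin.castLE hnm p.castSucc, Fin.castLE hnm (Fin.last k))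
        (deleteTreeEdges hnm H T).edgeSet ∧
    s(Fin.castLE hnm p.castSucc, Fin.castLE hnm (Fin.last k)) ∉
        (deleteTreeEdges hnm H T).edgeSet := by
  have hinj := Sym2.map.injective (Fin.castLE_injective hnm)
  have hset := edgeSet_eq_insert_of_leaf hl
  have hnot := leaf_edge_notMem (Fin.last k) p (T.comap (Fin.last k).succAbove)
  have himg : Sym2.map (Fin.castLE (Nat.le_of_succ_le hnm)) ''
      (T.comap (Fin.last k).succAbove).edgeSet = Sym2.map (Fin.castLE hnm) ''
        (Sym2.map (Fin.last k).succAboveEmb '' (T.comap (Fin.last k).succAbove).edgeSet) := by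
    rw [Set.image_image]
    refine Set.image_congr fun e _ => ?_
    rw [Sym2.map_map]
    congr 1
    ext i
    simp
  have hmem : s(p.castSucc, Fin.last k) ∈ T.edgeSet := by
    rw [hset, Fin.succAbove_last_apply]
    exact .inl rfl
  rw [Fin.succAbove_last_apply] at hnot hset
  have hH : Sym2.map (Fin.castLE hnm) s(p.castSucc, Fin.last k) ∈ H.edgeSet := hT _ _ hmem
  rw [← Sym2.map_mk]
  simp only [deleteTreeEdges, SimpleGraph.edgeSet_deleteEdges, himg]
  refine ⟨?_, fun h => h.2 ⟨_, hmem, rfl⟩⟩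
  rw [hset, Set.image_insert_eq]
  have hnot' := mt hinj.mem_set_image.1 hnot
  ext e
  by_cases he : e = Sym2.map (Fin.castLE hnm) s(p.castSucc, Fin.last k)
  · subst he
    exact ⟨fun _ => .inl rfl, fun _ => ⟨hH, hnot'⟩⟩
  · simp only [Set.mem_sdiff, Set.mem_insert_iff, he, false_or]

theorem extAssign_insertNth (hnm : k + 1 ≤ m + 1) (y : Fin k → I) (z w : I) (x : Fin m → I) :
    extAssign hnm ((Fin.last k).insertNth z y)
        ((Fin.castLE hnm (Fin.last k)).insertNth w x) =
      extAssign (Nat.le_of_succ_le hnm) y ((Fin.castLE hnm (Fin.last k)).insertNth z x) := by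
  funext i
  rcases Fin.eq_self_or_eq_succAbove (Fin.castLE hnm (Fin.last k)) i with rfl | ⟨j, rfl⟩
  · have h : (⟨k, k.lt_succ_self⟩ : Fin (k + 1)) = Fin.last k := rfl
    simp [extAssign, h]
  · have hne : ((Fin.castLE hnm (Fin.last k)).succAbove j : ℕ) ≠ k := fun h =>
      Fin.succAbove_ne _ j (Fin.ext h)
    by_cases h : ((Fin.castLE hnm (Fin.last k)).succAbove j : ℕ) < k
    · have h' : (⟨_, h.trans k.lt_succ_self⟩ : Fin (k + 1)) =
        (Fin.last k).succAbove ⟨_, h⟩ := by simp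
      simp only [extAssign, h, h.trans k.lt_succ_self, dite_true]
      rw [h', Fin.insertNth_apply_succAbove]
    · have h' : ¬ ((Fin.castLE hnm (Fin.last k)).succAbove j : ℕ) < k + 1 := by omega
      simp only [extAssign, h, h', dite_false, Fin.insertNth_apply_succAbove]

theorem restrictedDensity_insertNth {W : I → I → ℝ} (hW : PosBdd (Function.uncurry W))
    (hsym : ∀ x y, W x y = W y x) (hnm : k + 1 ≤ m + 1) (G : SimpleGraph (Fin (m + 1)))
    (y : Fin k → I) (z : I) :
    restrictedDensity hnm G W hsym ((Fin.last k).insertNth z y) =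
      ∫ x : Fin m → I, edgeProd G W hsym (extAssign (Nat.le_of_succ_le hnm) y
        ((Fin.castLE hnm (Fin.last k)).insertNth z x)) := by
  unfold restrictedDensity
  rw [integral_eq_integral_insertNth (Fin.castLE hnm (Fin.last k))
    (((posBdd_edgeProd hW hsym G).comp (measurable_extAssign hnm)).bddMeas.comp
      measurable_prodMk_left)]
  simp only [extAssign_insertNth, integral_const, probReal_univ, one_smul]

theorem restrictedDensity_eq_integral {W : I → I → ℝ} (hW : PosBdd (Function.uncurry W))
    (hsym : ∀ x y, W x y = W y x) (hnm : k + 1 ≤ m + 1) {G G' : SimpleGraph (Fin (m + 1))}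
    {p : Fin k}
    (h : G'.edgeSet = insert s(Fin.castLE hnm p.castSucc, Fin.castLE hnm (Fin.last k)) G.edgeSet)
    (hnot : s(Fin.castLE hnm p.castSucc, Fin.castLE hnm (Fin.last k)) ∉ G.edgeSet)
    (y : Fin k → I) :
    restrictedDensity (Nat.le_of_succ_le hnm) G' W hsym y =
      ∫ z, W (y p) z * restrictedDensity hnm G W hsym ((Fin.last k).insertNth z y) := by
  have hedge := edgeProd_of_edgeSet_eq_insert hsym (.refl _) (W := W) (G := G') (G' := G)
    (a := Fin.castLE hnm p.castSucc) (b := Fin.castLE hnm (Fin.last k))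
    (by simpa using h) (by simpa using hnot)
  simp only [Function.Embedding.coe_refl, Function.comp_id] at hedge
  simp only [restrictedDensity_insertNth hW, ← integral_const_mul]
  unfold restrictedDensity
  rw [integral_eq_integral_insertNth (Fin.castLE hnm (Fin.last k))
    (((posBdd_edgeProd hW hsym G').comp (measurable_extAssign _)).bddMeas.comp
      measurable_prodMk_left)]
  have hl (x : Fin (m + 1) → I) : extAssign (Nat.le_of_succ_le hnm) y x
      (Fin.castLE hnm (Fin.last k)) = x (Fin.castLE hnm (Fin.last k)) := by
    simp [extAssign]
  have hp (x : Fin (m + 1) → I) : extAssign (Nat.le_of_succ_le hnm) y x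
      (Fin.castLE hnm p.castSucc) = y p := by
    simp [extAssign]
  simp only [hedge, hl, hp, Fin.insertNth_apply_same]

theorem log_kernelDensity_le_integral {W : I → I → ℝ} (hW : PosBdd (Function.uncurry W)) :
    Real.log (kernelDensity W) ≤
      (kernelDensity W)⁻¹ * ∫ x, kernelDeg W x * Real.log (kernelDeg W x) := by
  have hd := kernelDensity_pos hW
  have hdeg := posBdd_kernelDeg hW
  have h1 : ∫ x, (kernelDensity W)⁻¹ * kernelDeg W x = 1 := by
    rw [integral_const_mul]
    exact inv_mul_cancel₀ hd.ne'
  have h := integral_density_mul_log_le volume ((posBdd_const (inv_pos.2 hd)).mul hdeg) h1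
    hdeg.inv
  simp only [mul_assoc, mul_inv_cancel₀ (hdeg.pos _).ne', Real.log_inv, mul_neg,
    integral_neg, integral_const_mul] at h
  simp only [mul_one, integral_const, probReal_univ, one_smul, Real.log_inv] at h
  linarith

theorem IsSmooth.comap_succAbove_last (hnm : k + 2 ≤ m + 1) {H : SimpleGraph (Fin (m + 1))}
    {T : SimpleGraph (Fin (k + 2))} (htree : T.IsTree)
    (hT : ∀ i j, T.Adj i j → H.Adj (Fin.castLE hnm i) (Fin.castLE hnm j))
    (hleaf : T.degree (Fin.last (k + 1)) = 1) (hsmooth : IsSmooth hnm H T) :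
    IsSmooth (Nat.le_of_succ_le hnm) H (T.comap (Fin.last (k + 1)).succAbove) := by
  intro W hmeas hlow hupp hsym
  have hW : PosBdd (Function.uncurry W) := by
    obtain ⟨c, hc, hcW⟩ := hlow
    obtain ⟨C, hC⟩ := hupp
    exact ⟨hmeas, ⟨c, hc, fun x => hcW _ _⟩, C, fun x => hC _ _⟩
  have hsm := hsmooth W hmeas hlow hupp hsym
  obtain ⟨p, hl⟩ := exists_adj_iff_of_degree_eq_one hleaf
  obtain ⟨hset, hnot⟩ := deleteTreeEdges_edgeSet hnm hT hl
  have htree' := isTree_comap_succAbove htree hleaf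
  have hweight := treeWeight_insertNth hW hsym hl hleaf
  generalize T.comap (Fin.last (k + 1)).succAbove = T' at *
  generalize deleteTreeEdges hnm H T = G at *
  generalize deleteTreeEdges (Nat.le_of_succ_le hnm) H T' = G' at *
  have hcard : G'.edgeFinset.card = G.edgeFinset.card + 1 := by
    rw [← Finset.card_insert_of_notMem (mt SimpleGraph.mem_edgeFinset.1 hnot)]
    congr 1
    ext e
    simp [hset]
  have hd := kernelDensity_pos hW
  have hdeg := posBdd_kernelDeg hW
  have htw := posBdd_treeWeight hW hsym T'
  have hτ := posBdd_restrictedDensity hnm hW hsym G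
  have hτ' := posBdd_restrictedDensity (Nat.le_of_succ_le hnm) hW hsym G'
  have hF := (posBdd_treeWeight hW hsym T).bddMeas.mul hτ.log
  have hFint : Integrable fun y : Fin (k + 1) → I => ∫ z,
      treeWeight T W hsym ((Fin.last (k + 1)).insertNth z y) *
        Real.log (restrictedDensity hnm G W hsym ((Fin.last (k + 1)).insertNth z y)) :=
    (((hF.comp (measurable_insertNth _)).comp measurable_swap).integral volume).integrable _
  have hlogdeg := htw.bddMeas.mul (hdeg.log.comp (measurable_pi_apply p))
  have hlogτ' := htw.bddMeas.mul hτ'.log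
  have hpt (y : Fin (k + 1) → I) :
      ∫ z, treeWeight T W hsym ((Fin.last (k + 1)).insertNth z y) *
        Real.log (restrictedDensity hnm G W hsym ((Fin.last (k + 1)).insertNth z y)) ≤
      treeWeight T' W hsym y *
          Real.log (restrictedDensity (Nat.le_of_succ_le hnm) G' W hsym y) -
        treeWeight T' W hsym y * Real.log (kernelDeg W (y p)) := by
    have hρ : PosBdd fun z => (kernelDeg W (y p))⁻¹ * W (y p) z :=
      hW.leafDensity.comp measurable_prodMk_left
    have hρ1 : ∫ z, (kernelDeg W (y p))⁻¹ * W (y p) z = 1 := by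
      rw [integral_const_mul]
      exact inv_mul_cancel₀ (hdeg.pos _).ne'
    have hJ := integral_density_mul_log_le volume hρ hρ1
      ((hτ.comp (measurable_insertNth (Fin.last (k + 1)))).comp
        (measurable_prodMk_right (y := y)))
    have hsplit : ∫ z, (kernelDeg W (y p))⁻¹ * W (y p) z *
          restrictedDensity hnm G W hsym ((Fin.last (k + 1)).insertNth z y) =
        (kernelDeg W (y p))⁻¹ *
          restrictedDensity (Nat.le_of_succ_le hnm) G' W hsym y := by
      simp only [mul_assoc, integral_const_mul,
        restrictedDensity_eq_integral hW hsym hnm hset hnot]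
    rw [hsplit, Real.log_mul (inv_pos.2 (hdeg.pos _)).ne' (hτ'.pos _).ne', Real.log_inv] at hJ
    simp only [hweight, mul_assoc (treeWeight _ _ _ _), integral_const_mul]
    rw [← mul_sub]
    refine mul_le_mul_of_nonneg_left ?_ (htw.pos y).le
    linarith
  have hint := integral_mono hFint ((hlogτ'.integrable volume).sub (hlogdeg.integrable volume)) hpt
  simp only [Pi.sub_apply] at hint
  rw [integral_sub (hlogτ'.integrable _) (hlogdeg.integrable _),
    ← integral_eq_integral_insertNth_symm _ hF,
    integral_treeWeight_mul hW hsym T' htree' p hdeg.log] at hint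
  have hent := log_kernelDensity_le_integral hW
  rw [hcard]
  push_cast
  linarith

end Main

/-- Unlabeling lemma: if the tree `T` spanned on the labeled set `S = {x₁,…,x_n}` is smooth
in the bipartite graph `H`, and `x_n` is a leaf of `T`, then the subtree `T' = T − x_n` on
`S' = S ∖ {x_n}` is smooth in `H` (with `x_n` unlabeled). -/
theorem unlabeling (m n : ℕ) (hn : 2 ≤ n) (hnm : n ≤ m)
    (H : SimpleGraph (Fin m)) (hbip : H.Colorable 2)
    (T : SimpleGraph (Fin n)) (htree : T.IsTree)
    (hind : ∀ i j : Fin n, T.Adj i j ↔ H.Adj (Fin.castLE hnm i) (Fin.castLE hnm j))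
    (hleaf : T.degree ⟨n - 1, by omega⟩ = 1)
    (T' : SimpleGraph (Fin (n - 1)))
    (hT' : ∀ i j : Fin (n - 1), T'.Adj i j ↔
      T.Adj (Fin.castLE (by omega) i) (Fin.castLE (by omega) j))
    (hsmooth : IsSmooth hnm H T) :
    IsSmooth (show n - 1 ≤ m by omega) H T' := by
  obtain ⟨k, rfl⟩ : ∃ k, n = k + 2 := ⟨n - 2, by omega⟩
  obtain ⟨m, rfl⟩ : ∃ l, m = l + 1 := ⟨m - 1, by omega⟩
  have hcomap : T' = T.comap (Fin.last (k + 1)).succAbove := by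
    ext i j
    rw [hT', SimpleGraph.comap_adj, Fin.succAbove_last_apply, Fin.succAbove_last_apply]
    rfl
  subst hcomap
  exact IsSmooth.comap_succAbove_last hnm htree (fun i j => (hind i j).1) hleaf hsmooth
end
end
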